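/- Suppose the real eigenvalue sequence E_1 < E_2 < ⋯ satisfies the lower gap bound |E_m − E_n| ≥ c_H·|m−n|/max{m,n}^{2γ} for all m,n ≥ 1, for some γ ∈ (0,1/2) and c_H > 0. Let i ≥ 1 be an integer and r > 2. Let Y be a bounded self-adjoint diagonal operator with ‖Y‖_{∞,γ} < ∞ and let Z̄ be a bounded self-adjoint operator with ‖Z̄‖_{r,iγ} < ∞, and assume ‖Y‖_{∞,γ} + ‖Z̄‖_{r,iγ} ≤ c_H/(4π·C_{r+1}). Then there exists a unitary operator U on ℋ and a bounded self-adjoint diagonal operator A with ‖A‖_{∞,γ} ≤ 2(‖Y‖_{∞,γ} + ‖Z̄‖_{r,iγ}) such that: U* maps Dom(H) onto Dom(H) and U(H+Y+Z̄)U*ψ = Hψ + Aψ for every ψ ∈ Dom(H); moreover, for every bounded operator X with ‖X‖_{r−1,(i+1)γ} < ∞ one has ‖UXU*‖_{r−1,(i+1)γ} ≤ exp(2C_r/C_{r+1})·‖X‖_{r−1,(i+1)γ}. -/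

import Mathlib

noncomputable section

open ContinuousLinearMap

variable {𝓗 : Type*} [NormedAddCommGroup 𝓗] [InnerProductSpace ℂ 𝓗] [CompleteSpace 𝓗]

/-- `⟨x⟩ := max {1, |x|}`. -/
def jap (x : ℝ) : ℝ := max 1 |x|

/-- `(Pₙ)_{n≥1}` is a family of mutually orthogonal nonzero orthogonal projections
with `Σₙ Pₙ = I` in the strong sense. -/
def ProjFamily (P : ℕ+ → 𝓗 →L[ℂ] 𝓗) : Prop :=
  (∀ n, IsSelfAdjoint (P n)) ∧ (∀ n, (P n).comp (P n) = P n) ∧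
  (∀ m n, m ≠ n → (P m).comp (P n) = 0) ∧ (∀ n, P n ≠ 0) ∧
  (∀ ψ : 𝓗, HasSum (fun n => P n ψ) ψ)

/-- The quantity `⟨m-n⟩^p · max{m,n}^(2δ) · ‖Pₘ A Pₙ‖`; the norm `‖A‖_{p,δ}` is its
supremum over `m, n ≥ 1`. -/
def wnorm (P : ℕ+ → 𝓗 →L[ℂ] 𝓗) (p δ : ℝ) (A : 𝓗 →L[ℂ] 𝓗) (m n : ℕ+) : ℝ :=
  jap (((m : ℕ) : ℝ) - ((n : ℕ) : ℝ)) ^ p * (((max m n : ℕ+) : ℕ) : ℝ) ^ (2 * δ) *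
    ‖(P m).comp (A.comp (P n))‖

/-- `A` is diagonal with respect to the family `P`. -/
def IsDiag (P : ℕ+ → 𝓗 →L[ℂ] 𝓗) (A : 𝓗 →L[ℂ] 𝓗) : Prop :=
  ∀ m n, m ≠ n → (P m).comp (A.comp (P n)) = 0

/-- `Dom(H) = {ψ : Σₙ Eₙ²‖Pₙψ‖² < ∞}`. -/
def HDom (P : ℕ+ → 𝓗 →L[ℂ] 𝓗) (E : ℕ+ → ℝ) : Set 𝓗 :=
  {ψ | Summable fun n => (E n) ^ 2 * ‖P n ψ‖ ^ 2}

/-- The form domain `Q_H = {ψ : Σₙ Eₙ‖Pₙψ‖² < ∞}`. -/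
def QDom (P : ℕ+ → 𝓗 →L[ℂ] 𝓗) (E : ℕ+ → ℝ) : Set 𝓗 :=
  {ψ | Summable fun n => E n * ‖P n ψ‖ ^ 2}

/-- `h = Hψ`, i.e. `h = Σₙ Eₙ Pₙ ψ`. -/
def IsHSum (P : ℕ+ → 𝓗 →L[ℂ] 𝓗) (E : ℕ+ → ℝ) (ψ h : 𝓗) : Prop :=
  HasSum (fun n => (E n : ℂ) • P n ψ) h

/-- `U` is unitary. -/
def IsUnitaryOp (U : 𝓗 →L[ℂ] 𝓗) : Prop := U * star U = 1 ∧ star U * U = 1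

/-- A family of bounded operators which is `C¹` in the strong sense. -/
def StrongC1 (V : ℝ → 𝓗 →L[ℂ] 𝓗) : Prop := ∀ ψ : 𝓗, ContDiff ℝ 1 fun t => V t ψ

/-- `U(t,s)` is a propagator for `H + V(t)`. -/
def IsPropagator (P : ℕ+ → 𝓗 →L[ℂ] 𝓗) (E : ℕ+ → ℝ) (V : ℝ → 𝓗 →L[ℂ] 𝓗)
    (U : ℝ → ℝ → 𝓗 →L[ℂ] 𝓗) : Prop :=
  (∀ t s, IsUnitaryOp (U t s)) ∧
  (∀ ψ : 𝓗, Continuous fun ts : ℝ × ℝ => U ts.1 ts.2 ψ) ∧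
  (∀ t, U t t = 1) ∧
  (∀ t s r, (U t s).comp (U s r) = U t r) ∧
  (∀ t s, ⇑(U t s) '' HDom P E = HDom P E) ∧
  (∀ s : ℝ, ∀ ψ ∈ HDom P E, ∀ t : ℝ, ∃ d : 𝓗,
    HasDerivAt (fun τ => U τ s ψ) d t ∧
    ∀ h : 𝓗, IsHSum P E (U t s ψ) h → Complex.I • d = h + V t (U t s ψ))

/-- The Riemann zeta function `ζ(s) = Σ_{n≥1} n^{-s}` (for real `s > 1`). -/
def rzeta (s : ℝ) : ℝ := ∑' n : ℕ+, (((n : ℕ) : ℝ) ^ s)⁻¹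

/-- The constant `C_p = 2^(p+1) (1 + 2 ζ(p-1))`. -/
def Cconst (p : ℝ) : ℝ := 2 ^ (p + 1) * (1 + 2 * rzeta (p - 1))


/-! ### Scalar estimates -/

/-- The constant `1 + 2 ζ(p)`. -/
def Qc (p : ℝ) : ℝ := 1 + 2 * rzeta p

lemma jap_one_le (x : ℝ) : 1 ≤ jap x := le_max_left _ _

lemma jap_pos (x : ℝ) : 0 < jap x := lt_of_lt_of_le one_pos (jap_one_le x)

lemma jap_neg (x : ℝ) : jap (-x) = jap x := by simp [jap]

lemma rzeta_summable {p : ℝ} (hp : 1 < p) :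
    Summable fun n : ℕ+ => (((n : ℕ) : ℝ) ^ p)⁻¹ :=
  (Real.summable_nat_rpow_inv.mpr hp).comp_injective PNat.coe_injective

lemma rzeta_one_le {p : ℝ} (hp : 1 < p) : 1 ≤ rzeta p := by
  have := (rzeta_summable hp).le_tsum (1 : ℕ+) (fun j _ => by positivity)
  simpa [rzeta] using this

lemma Qc_three_le {p : ℝ} (hp : 1 < p) : 3 ≤ Qc p := by
  have := rzeta_one_le hp
  unfold Qc; linarith

lemma int_hasSum {p : ℝ} (hp : 1 < p) :
    HasSum (fun d : ℤ => (jap (d : ℝ) ^ p)⁻¹) (Qc p) := by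
  have h1 : HasSum (fun n : ℕ => (((n : ℝ) + 1) ^ p)⁻¹) (rzeta p) := by
    have := (rzeta_summable hp).hasSum
    have h2 := (Equiv.pnatEquivNat.symm.hasSum_iff).mpr this
    refine h2.congr_fun ?_ |> id
    intro n
    simp
  have hj : ∀ n : ℕ, jap ((n : ℝ) + 1) = n + 1 := by
    intro n
    have : (0 : ℝ) ≤ n := Nat.cast_nonneg n
    rw [jap, abs_of_nonneg (by linarith), max_eq_right (by linarith)]
  have h3 := HasSum.of_add_one_of_neg_add_one (f := fun d : ℤ => (jap (d : ℝ) ^ p)⁻¹)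
    (m := rzeta p) (m' := rzeta p) ?_ ?_
  · convert h3 using 1
    simp [Qc, jap]; ring
  · simpa [hj] using h1
  · have : ∀ n : ℕ, jap (-1 + -(n : ℝ)) = n + 1 := by
      intro n
      rw [← hj n, ← jap_neg]; congr 1; ring
    simpa [this] using h1

/-- `⟨m-l⟩^{-p}`. -/
def qk (p : ℝ) (m l : ℕ+) : ℝ := (jap (((m : ℕ) : ℝ) - ((l : ℕ) : ℝ)) ^ p)⁻¹

lemma qk_pos (p : ℝ) (m l : ℕ+) : 0 < qk p m l :=
  inv_pos.mpr (Real.rpow_pos_of_pos (jap_pos _) _)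

lemma qk_symm (p : ℝ) (m l : ℕ+) : qk p m l = qk p l m := by
  unfold qk; rw [← jap_neg]; congr 3; ring

lemma qk_inj (m : ℕ+) : Function.Injective fun l : ℕ+ => ((m : ℕ) : ℤ) - ((l : ℕ) : ℤ) := by
  intro a b h
  apply PNat.coe_injective
  simp only at h
  omega

lemma qk_summable {p : ℝ} (hp : 1 < p) (m : ℕ+) : Summable fun l => qk p m l := by
  have := (int_hasSum hp).summable.comp_injective (qk_inj m)
  refine this.congr ?_
  intro l; simp [qk]

lemma qk_tsum_le {p : ℝ} (hp : 1 < p) (m : ℕ+) : ∑' l, qk p m l ≤ Qc p := by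
  rw [← (int_hasSum hp).tsum_eq]
  refine (qk_summable hp m).tsum_le_tsum_of_inj _ (qk_inj m) ?_ ?_ (int_hasSum hp).summable
  · intro d _
    exact (inv_pos.mpr (Real.rpow_pos_of_pos (jap_pos _) _)).le
  · intro l
    simp [qk]

lemma jap_tri (a b : ℝ) : jap (a + b) ≤ jap a + jap b := by
  have := jap_one_le a
  have := jap_one_le b
  have := abs_add_le a b
  have : |a| ≤ jap a := le_max_right _ _
  have : |b| ≤ jap b := le_max_right _ _
  exact max_le (by linarith) (by linarith)

lemma qk_mul_le {p : ℝ} (hp : 0 < p) (m l n : ℕ+) :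
    qk p m l * qk p l n ≤ 2 ^ p * qk p m n * (qk p m l + qk p n l) := by
  rw [qk_symm p n l]
  have htri : jap (((m : ℕ) : ℝ) - ((n : ℕ) : ℝ)) ≤ jap (((m : ℕ) : ℝ) - ((l : ℕ) : ℝ)) +
      jap (((l : ℕ) : ℝ) - ((n : ℕ) : ℝ)) := by
    have := jap_tri (((m : ℕ) : ℝ) - ((l : ℕ) : ℝ)) (((l : ℕ) : ℝ) - ((n : ℕ) : ℝ))
    simpa using this
  unfold qk
  set a := jap (((m : ℕ) : ℝ) - ((l : ℕ) : ℝ))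
  set b := jap (((l : ℕ) : ℝ) - ((n : ℕ) : ℝ))
  set c := jap (((m : ℕ) : ℝ) - ((n : ℕ) : ℝ))
  have ha : 0 < a := jap_pos _
  have hb : 0 < b := jap_pos _
  have hc : 0 < c := jap_pos _
  have hap := Real.rpow_pos_of_pos ha p
  have hbp := Real.rpow_pos_of_pos hb p
  have hcp := Real.rpow_pos_of_pos hc p
  have key : c ^ p ≤ 2 ^ p * (a ^ p + b ^ p) := by
    rcases le_total a b with h | h
    · calc c ^ p ≤ (2 * b) ^ p := Real.rpow_le_rpow hc.le (by linarith) hp.le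
        _ = 2 ^ p * b ^ p := Real.mul_rpow (by norm_num) hb.le
        _ ≤ _ := by gcongr; linarith
    · calc c ^ p ≤ (2 * a) ^ p := Real.rpow_le_rpow hc.le (by linarith) hp.le
        _ = 2 ^ p * a ^ p := Real.mul_rpow (by norm_num) ha.le
        _ ≤ _ := by gcongr; linarith
  have : 2 ^ p * (c ^ p)⁻¹ * ((a ^ p)⁻¹ + (b ^ p)⁻¹) =
      ((a ^ p)⁻¹ * (b ^ p)⁻¹) * (2 ^ p * (a ^ p + b ^ p) / c ^ p) := by
    field_simp; ring
  rw [this]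
  refine le_mul_of_one_le_right (by positivity) ?_
  rwa [one_le_div hcp]

/-- `max{m,n}` as a real number. -/
def mx (m n : ℕ+) : ℝ := (((max m n : ℕ+) : ℕ) : ℝ)

lemma mx_one_le (m n : ℕ+) : 1 ≤ mx m n := by
  unfold mx; exact_mod_cast (max m n).pos

lemma mx_pos (m n : ℕ+) : 0 < mx m n := lt_of_lt_of_le one_pos (mx_one_le m n)

lemma mx_symm (m n : ℕ+) : mx m n = mx n m := by unfold mx; rw [max_comm]

lemma mx_eq (m n : ℕ+) : mx m n = max ((m : ℕ) : ℝ) ((n : ℕ) : ℝ) := by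
  unfold mx
  rcases le_total m n with h | h
  · have h' : ((m : ℕ) : ℝ) ≤ (n : ℕ) := by exact_mod_cast h
    rw [max_eq_right h, max_eq_right h']
  · have h' : ((n : ℕ) : ℝ) ≤ (m : ℕ) := by exact_mod_cast h
    rw [max_eq_left h, max_eq_left h']

lemma pn_one_le (m : ℕ+) : (1 : ℝ) ≤ ((m : ℕ) : ℝ) := by exact_mod_cast m.pos

lemma mx_mul (m l n : ℕ+) : mx m n ≤ mx m l * mx l n := by
  have h1 := pn_one_le m
  have h2 := pn_one_le l
  have h3 := pn_one_le n
  rw [mx_eq, mx_eq, mx_eq]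
  apply max_le
  · calc ((m : ℕ) : ℝ) = m * 1 := by ring
      _ ≤ _ := mul_le_mul (le_max_left _ _) (le_trans h2 (le_max_left _ _)) (by norm_num)
        (le_trans (by linarith) (le_max_left _ _))
  · calc ((n : ℕ) : ℝ) = 1 * n := by ring
      _ ≤ _ := mul_le_mul (le_trans h2 (le_max_right _ _)) (le_max_right _ _) (by linarith)
        (le_trans (by linarith) (le_max_left _ _))

lemma nat_le_jap (l n : ℕ+) :
    ((n : ℕ) : ℝ) ≤ 2 * jap (((l : ℕ) : ℝ) - ((n : ℕ) : ℝ)) * ((l : ℕ) : ℝ) := by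
  have h2 := pn_one_le l
  have hj := jap_one_le (((l : ℕ) : ℝ) - ((n : ℕ) : ℝ))
  have hj2 : |((l : ℕ) : ℝ) - ((n : ℕ) : ℝ)| ≤ jap (((l : ℕ) : ℝ) - ((n : ℕ) : ℝ)) :=
    le_max_right _ _
  have := (abs_le.mp hj2).1
  nlinarith

lemma mx_le_jap (m l n : ℕ+) :
    mx m n ≤ 2 * jap (((l : ℕ) : ℝ) - ((n : ℕ) : ℝ)) * mx m l := by
  have hj := jap_one_le (((l : ℕ) : ℝ) - ((n : ℕ) : ℝ))
  have h1 := nat_le_jap l n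
  have hm := pn_one_le m
  have hp := mx_pos m l
  have hml : ((m : ℕ) : ℝ) ≤ mx m l := by rw [mx_eq]; exact le_max_left _ _
  have hll : ((l : ℕ) : ℝ) ≤ mx m l := by rw [mx_eq]; exact le_max_right _ _
  rw [mx_eq m n]
  apply max_le
  · nlinarith
  · refine h1.trans ?_
    gcongr

/-- The weight estimate behind the product bound. -/
lemma weight_mul {p s j γ : ℝ} (hp : 0 < p) (hs : 0 ≤ s) (hj : 0 ≤ j) (hγ0 : 0 < γ)
    (hγ : γ < 1 / 2) (m l n : ℕ+) :
    (qk p m l / mx m l ^ (2 * (s + j * γ))) * (qk (p + j) l n / mx l n ^ (2 * s)) ≤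
      (2 ^ (p + j) * (qk p m n / mx m n ^ (2 * (s + j * γ)))) * (qk p m l + qk p n l) := by
  have h1 := qk_mul_le hp m l n
  have hJ1 := jap_one_le (((l : ℕ) : ℝ) - ((n : ℕ) : ℝ))
  have hJ := jap_pos (((l : ℕ) : ℝ) - ((n : ℕ) : ℝ))
  have e1 : qk (p + j) l n =
      qk p l n * (jap (((l : ℕ) : ℝ) - ((n : ℕ) : ℝ)) ^ j)⁻¹ := by
    unfold qk; rw [Real.rpow_add hJ, mul_inv]
  have hml := mx_pos m l
  have hln := mx_pos l n
  have hmn := mx_pos m n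
  have hA : mx m n ^ (2 * s) ≤ mx m l ^ (2 * s) * mx l n ^ (2 * s) := by
    rw [← Real.mul_rpow hml.le hln.le]
    exact Real.rpow_le_rpow hmn.le (mx_mul m l n) (by linarith)
  have hB : mx m n ^ (2 * (j * γ)) ≤
      2 ^ j * jap (((l : ℕ) : ℝ) - ((n : ℕ) : ℝ)) ^ j * mx m l ^ (2 * (j * γ)) := by
    have h0 : 0 ≤ 2 * (j * γ) := by positivity
    have h01 : 2 * (j * γ) ≤ j := by nlinarith
    calc mx m n ^ (2 * (j * γ))
        ≤ (2 * jap (((l : ℕ) : ℝ) - ((n : ℕ) : ℝ)) * mx m l) ^ (2 * (j * γ)) :=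
          Real.rpow_le_rpow hmn.le (mx_le_jap m l n) h0
      _ = (2 * jap (((l : ℕ) : ℝ) - ((n : ℕ) : ℝ))) ^ (2 * (j * γ)) *
          mx m l ^ (2 * (j * γ)) := Real.mul_rpow (by positivity) hml.le
      _ ≤ (2 * jap (((l : ℕ) : ℝ) - ((n : ℕ) : ℝ))) ^ j * mx m l ^ (2 * (j * γ)) := by
          gcongr
          linarith
      _ = _ := by rw [Real.mul_rpow (by norm_num) hJ.le]
  set J := jap (((l : ℕ) : ℝ) - ((n : ℕ) : ℝ)) ^ j with hJdef
  have hJp : 0 < J := Real.rpow_pos_of_pos hJ _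
  have e2 : ∀ a b : ℕ+, mx a b ^ (2 * (s + j * γ)) = mx a b ^ (2 * s) * mx a b ^ (2 * (j * γ)) := by
    intro a b
    rw [← Real.rpow_add (mx_pos a b)]; congr 1; ring
  rw [e1, e2 m l, e2 m n, Real.rpow_add (by norm_num : (0 : ℝ) < 2)]
  have p1 := Real.rpow_pos_of_pos hml (2 * s)
  have p2 := Real.rpow_pos_of_pos hln (2 * s)
  have p3 := Real.rpow_pos_of_pos hmn (2 * s)
  have p4 := Real.rpow_pos_of_pos hml (2 * (j * γ))
  have p5 := Real.rpow_pos_of_pos hmn (2 * (j * γ))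
  have p6 : (0 : ℝ) < 2 ^ j := Real.rpow_pos_of_pos (by norm_num) _
  have hC := mul_le_mul hA hB p5.le (by positivity)
  calc (qk p m l / (mx m l ^ (2 * s) * mx m l ^ (2 * (j * γ)))) *
        (qk p l n * J⁻¹ / mx l n ^ (2 * s))
      = (qk p m l * qk p l n) *
        (2 ^ j / (mx m l ^ (2 * s) * mx l n ^ (2 * s) * (2 ^ j * J * mx m l ^ (2 * (j * γ))))) := by
        field_simp
    _ ≤ (2 ^ p * qk p m n * (qk p m l + qk p n l)) *
        (2 ^ j / (mx m n ^ (2 * s) * mx m n ^ (2 * (j * γ)))) := by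
        have := (qk_pos p m l)
        have := (qk_pos p l n)
        have := (qk_pos p m n)
        have := (qk_pos p n l)
        gcongr
    _ = _ := by ring


/-! ### The projection family -/

open scoped InnerProductSpace

section proj
variable {P : ℕ+ → 𝓗 →L[ℂ] 𝓗}

lemma pf_star (hP : ProjFamily P) (n : ℕ+) : star (P n) = P n := hP.1 n

lemma pf_idem (hP : ProjFamily P) (n : ℕ+) : P n * P n = P n := hP.2.1 n

lemma pf_orth (hP : ProjFamily P) {m n : ℕ+} (h : m ≠ n) : P m * P n = 0 := hP.2.2.1 m n h

lemma pf_sum (hP : ProjFamily P) (ψ : 𝓗) : HasSum (fun n => P n ψ) ψ := hP.2.2.2.2 ψ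

lemma pf_idem_apply (hP : ProjFamily P) (n : ℕ+) (ψ : 𝓗) : P n (P n ψ) = P n ψ :=
  congrArg (fun A : 𝓗 →L[ℂ] 𝓗 => A ψ) (pf_idem hP n)

lemma pf_orth_apply (hP : ProjFamily P) {m n : ℕ+} (h : m ≠ n) (ψ : 𝓗) : P m (P n ψ) = 0 :=
  congrArg (fun A : 𝓗 →L[ℂ] 𝓗 => A ψ) (pf_orth hP h)

lemma pf_inner (hP : ProjFamily P) (n : ℕ+) (x y : 𝓗) : ⟪P n x, y⟫_ℂ = ⟪x, P n y⟫_ℂ := by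
  have h := ContinuousLinearMap.adjoint_inner_left (P n) y x
  rw [← ContinuousLinearMap.star_eq_adjoint, pf_star hP] at h
  exact h

lemma pf_inner_self (hP : ProjFamily P) (n : ℕ+) (x : 𝓗) :
    ⟪x, P n x⟫_ℂ = ((‖P n x‖ ^ 2 : ℝ) : ℂ) := by
  rw [← pf_idem_apply hP, ← pf_inner hP, inner_self_eq_norm_sq_to_K]
  simp [pf_idem_apply hP]

lemma pf_sq (hP : ProjFamily P) (x : 𝓗) : HasSum (fun n => ‖P n x‖ ^ 2) (‖x‖ ^ 2) := by
  have h := (pf_sum hP x).mapL (innerSL ℂ x)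
  simp only [innerSL_apply_apply, pf_inner_self hP, inner_self_eq_norm_sq_to_K] at h
  have h2 : HasSum (fun n => ((‖P n x‖ ^ 2 : ℝ) : ℂ)) ((‖x‖ ^ 2 : ℝ) : ℂ) := by
    simpa using h
  exact_mod_cast h2

lemma pf_le (hP : ProjFamily P) (n : ℕ+) (x : 𝓗) : ‖P n x‖ ≤ ‖x‖ := by
  have := le_hasSum (pf_sq hP x) n (fun j _ => by positivity)
  exact le_of_sq_le_sq this (norm_nonneg _)

lemma pf_norm (hP : ProjFamily P) (n : ℕ+) : ‖P n‖ ≤ 1 :=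
  ContinuousLinearMap.opNorm_le_bound _ zero_le_one fun x => by simpa using pf_le hP n x

lemma pf_ext_vec (hP : ProjFamily P) {x y : 𝓗} (h : ∀ m, P m x = P m y) : x = y := by
  have h1 := pf_sum hP x
  simp only [h] at h1
  exact h1.unique (pf_sum hP y)

lemma pf_ext (hP : ProjFamily P) {A B : 𝓗 →L[ℂ] 𝓗}
    (h : ∀ m n, P m * A * P n = P m * B * P n) : A = B := by
  ext x
  apply pf_ext_vec hP
  intro m
  have h1 := (pf_sum hP x).mapL (P m * A)
  have h2 := (pf_sum hP x).mapL (P m * B)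
  have h3 : (fun n => (P m * A) (P n x)) = fun n => (P m * B) (P n x) := by
    funext n
    exact congrArg (fun A : 𝓗 →L[ℂ] 𝓗 => A x) (h m n)
  rw [h3] at h1
  exact h1.unique h2

lemma diag_left (hP : ProjFamily P) {A : 𝓗 →L[ℂ] 𝓗} (hA : IsDiag P A) (m : ℕ+) :
    P m * A = P m * A * P m := by
  apply pf_ext hP
  intro k n
  by_cases hn : n = m
  · subst hn
    simp only [mul_assoc, pf_idem hP]
  · have h1 : P m * (A * P n) = 0 := hA m n (Ne.symm hn)
    have h2 : P m * P n = 0 := pf_orth hP (Ne.symm hn)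
    simp only [mul_assoc, h1, h2, mul_zero]

lemma diag_right (hP : ProjFamily P) {A : 𝓗 →L[ℂ] 𝓗} (hA : IsDiag P A) (n : ℕ+) :
    A * P n = P n * A * P n := by
  apply pf_ext hP
  intro m k
  by_cases hn : m = n
  · subst hn
    simp only [← mul_assoc, pf_idem hP]
  · have h1 : P m * A * P n = 0 := by rw [mul_assoc]; exact hA m n hn
    have h2 : P m * P n = 0 := pf_orth hP hn
    simp only [← mul_assoc, h1, h2, zero_mul]

lemma diag_comm (hP : ProjFamily P) {A : 𝓗 →L[ℂ] 𝓗} (hA : IsDiag P A) (n : ℕ+) :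
    A * P n = P n * A := by
  rw [diag_left hP hA, diag_right hP hA]

lemma comm_diag (hP : ProjFamily P) {A : 𝓗 →L[ℂ] 𝓗} (hA : ∀ n, A * P n = P n * A) :
    IsDiag P A := by
  intro m n h
  change P m * (A * P n) = 0
  rw [hA, ← mul_assoc, pf_orth hP h, zero_mul]

/-! ### Building operators from blocks -/

lemma qk_double {p : ℝ} (hp : 1 < p) {a : ℕ+ → ℝ} {b : ℝ} (ha : ∀ n, 0 ≤ a n)
    (hs : HasSum a b) : Summable (fun mn : ℕ+ × ℕ+ => qk p mn.1 mn.2 * a mn.1) ∧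
      ∑' mn : ℕ+ × ℕ+, qk p mn.1 mn.2 * a mn.1 ≤ Qc p * b := by
  have hin : ∀ m : ℕ+, ∑' n : ℕ+, qk p m n * a m ≤ Qc p * a m := by
    intro m
    rw [tsum_mul_right]
    exact mul_le_mul_of_nonneg_right (qk_tsum_le hp m) (ha m)
  have hS : Summable (fun mn : ℕ+ × ℕ+ => qk p mn.1 mn.2 * a mn.1) := by
    rw [summable_prod_of_nonneg (fun mn => mul_nonneg (qk_pos _ _ _).le (ha _))]
    constructor
    · intro m
      exact (qk_summable hp m).mul_right (a m)
    · exact Summable.of_nonneg_of_le (fun m => tsum_nonneg fun n =>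
        mul_nonneg (qk_pos _ _ _).le (ha _)) hin (hs.summable.mul_left (Qc p))
  refine ⟨hS, ?_⟩
  rw [hS.tsum_prod, ← hs.tsum_eq, ← tsum_mul_left]
  exact Summable.tsum_le_tsum hin hS.prod (hs.summable.mul_left (Qc p))

set_option maxHeartbeats 1000000 in
lemma build_aux (hP : ProjFamily P) {p c : ℝ} (hp : 1 < p) (hc : 0 ≤ c)
    (w : ℕ+ → ℕ+ → 𝓗 →L[ℂ] 𝓗) (hw : ∀ m n, P m * w m n * P n = w m n)
    (hb : ∀ m n, ‖w m n‖ ≤ c * qk p m n) (x y : 𝓗) :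
    Summable (fun mn : ℕ+ × ℕ+ => ⟪w mn.1 mn.2 x, y⟫_ℂ) ∧
    ‖∑' mn : ℕ+ × ℕ+, ⟪w mn.1 mn.2 x, y⟫_ℂ‖ ≤ c * Qc p * ‖x‖ * ‖y‖ := by
  have hterm : ∀ m n, ‖⟪w m n x, y⟫_ℂ‖ ≤ c * qk p m n * (‖P n x‖ * ‖P m y‖) := by
    intro m n
    have e : w m n x = P m (w m n (P n x)) := by
      exact (congrArg (fun A : 𝓗 →L[ℂ] 𝓗 => A x) (hw m n)).symm
    rw [e, pf_inner hP]
    calc _ ≤ ‖w m n (P n x)‖ * ‖P m y‖ := norm_inner_le_norm _ _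
      _ ≤ (‖w m n‖ * ‖P n x‖) * ‖P m y‖ := by gcongr; exact ContinuousLinearMap.le_opNorm _ _
      _ ≤ (c * qk p m n * ‖P n x‖) * ‖P m y‖ := by gcongr; exact hb m n
      _ = _ := by ring
  have hQ : 0 ≤ Qc p := le_trans (by norm_num) (Qc_three_le hp)
  have hsum : ∀ z : 𝓗, Summable (fun mn : ℕ+ × ℕ+ => qk p mn.1 mn.2 * ‖P mn.1 z‖ ^ 2) ∧
      ∑' mn : ℕ+ × ℕ+, qk p mn.1 mn.2 * ‖P mn.1 z‖ ^ 2 ≤ Qc p * ‖z‖ ^ 2 := fun z =>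
    qk_double hp (fun n => by positivity) (pf_sq hP z)
  by_cases h0 : x = 0 ∨ y = 0
  · have hz : ∀ mn : ℕ+ × ℕ+, ⟪w mn.1 mn.2 x, y⟫_ℂ = 0 := by
      intro mn
      rcases h0 with h | h <;> simp [h]
    simp only [hz, tsum_zero, norm_zero]
    exact ⟨summable_zero, by positivity⟩
  push Not at h0
  have hx : 0 < ‖x‖ := norm_pos_iff.mpr h0.1
  have hy : 0 < ‖y‖ := norm_pos_iff.mpr h0.2
  obtain ⟨s1, t1⟩ := hsum y
  obtain ⟨s2, t2⟩ := hsum x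
  have s2' : Summable (fun mn : ℕ+ × ℕ+ => qk p mn.1 mn.2 * ‖P mn.2 x‖ ^ 2) := by
    have := (Equiv.prodComm ℕ+ ℕ+).summable_iff.mpr s2
    refine this.congr fun mn => ?_
    simp [qk_symm p mn.1 mn.2]
  have t2' : ∑' mn : ℕ+ × ℕ+, qk p mn.1 mn.2 * ‖P mn.2 x‖ ^ 2 ≤ Qc p * ‖x‖ ^ 2 := by
    rw [← (Equiv.prodComm ℕ+ ℕ+).tsum_eq] at t2
    refine le_trans (le_of_eq ?_) t2
    refine tsum_congr fun mn => ?_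
    simp [qk_symm p mn.1 mn.2]
  have hS := ((s1.mul_left (‖x‖ / ‖y‖)).add (s2'.mul_left (‖y‖ / ‖x‖))).mul_left (c / 2)
  have hle : ∀ mn : ℕ+ × ℕ+, ‖⟪w mn.1 mn.2 x, y⟫_ℂ‖ ≤
      c / 2 * (‖x‖ / ‖y‖ * (qk p mn.1 mn.2 * ‖P mn.1 y‖ ^ 2) +
        ‖y‖ / ‖x‖ * (qk p mn.1 mn.2 * ‖P mn.2 x‖ ^ 2)) := by
    intro mn
    refine (hterm mn.1 mn.2).trans ?_
    have hq := (qk_pos p mn.1 mn.2).le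
    have amgm : ‖P mn.2 x‖ * ‖P mn.1 y‖ ≤ 1 / 2 * (‖x‖ / ‖y‖ * ‖P mn.1 y‖ ^ 2 +
        ‖y‖ / ‖x‖ * ‖P mn.2 x‖ ^ 2) := by
      have e : 1 / 2 * (‖x‖ / ‖y‖ * ‖P mn.1 y‖ ^ 2 + ‖y‖ / ‖x‖ * ‖P mn.2 x‖ ^ 2) -
          ‖P mn.2 x‖ * ‖P mn.1 y‖ =
          (‖x‖ * ‖P mn.1 y‖ - ‖y‖ * ‖P mn.2 x‖) ^ 2 / (2 * ‖x‖ * ‖y‖) := by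
        field_simp; ring
      have : 0 ≤ (‖x‖ * ‖P mn.1 y‖ - ‖y‖ * ‖P mn.2 x‖) ^ 2 / (2 * ‖x‖ * ‖y‖) := by positivity
      linarith
    calc _ ≤ c * qk p mn.1 mn.2 * (1 / 2 * (‖x‖ / ‖y‖ * ‖P mn.1 y‖ ^ 2 +
        ‖y‖ / ‖x‖ * ‖P mn.2 x‖ ^ 2)) := by gcongr
      _ = _ := by ring
  refine ⟨Summable.of_norm_bounded hS hle, ?_⟩
  refine (tsum_of_norm_bounded hS.hasSum hle).trans ?_
  rw [tsum_mul_left, ((s1.mul_left (‖x‖ / ‖y‖))).tsum_add (s2'.mul_left (‖y‖ / ‖x‖)),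
    tsum_mul_left, tsum_mul_left]
  calc _ ≤ c / 2 * (‖x‖ / ‖y‖ * (Qc p * ‖y‖ ^ 2) + ‖y‖ / ‖x‖ * (Qc p * ‖x‖ ^ 2)) :=
        mul_le_mul_of_nonneg_left (add_le_add (mul_le_mul_of_nonneg_left t1 (by positivity))
          (mul_le_mul_of_nonneg_left t2' (by positivity))) (by positivity)
    _ = _ := by field_simp; ring

lemma build (hP : ProjFamily P) {p c : ℝ} (hp : 1 < p) (hc : 0 ≤ c)
    (w : ℕ+ → ℕ+ → 𝓗 →L[ℂ] 𝓗) (hw : ∀ m n, P m * w m n * P n = w m n)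
    (hb : ∀ m n, ‖w m n‖ ≤ c * qk p m n) :
    ∃ W : 𝓗 →L[ℂ] 𝓗, (∀ m n, P m * W * P n = w m n) ∧ ‖W‖ ≤ c * Qc p := by
  have hS := fun x y => (build_aux hP hp hc w hw hb x y).1
  let f : 𝓗 →ₛₗ[starRingEnd ℂ] 𝓗 →ₛₗ[RingHom.id ℂ] ℂ :=
    LinearMap.mk₂'ₛₗ (starRingEnd ℂ) (RingHom.id ℂ)
      (fun x y => ∑' mn : ℕ+ × ℕ+, ⟪w mn.1 mn.2 x, y⟫_ℂ)
      (by
        intro x x' y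
        rw [← (hS x y).tsum_add (hS x' y)]
        exact tsum_congr fun mn => by rw [map_add, inner_add_left])
      (by
        intro a x y
        rw [smul_eq_mul, ← tsum_mul_left]
        exact tsum_congr fun mn => by rw [map_smul, inner_smul_left])
      (by
        intro x y y'
        rw [← (hS x y).tsum_add (hS x y')]
        exact tsum_congr fun mn => by rw [inner_add_right])
      (by
        intro a x y
        rw [smul_eq_mul, ← tsum_mul_left]
        exact tsum_congr fun mn => by rw [inner_smul_right]; rfl)
  have hf : ∀ x y, ‖f x y‖ ≤ c * Qc p * ‖x‖ * ‖y‖ :=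
    fun x y => (build_aux hP hp hc w hw hb x y).2
  let B := f.mkContinuous₂ _ hf
  let W := InnerProductSpace.continuousLinearMapOfBilin B
  have hW : ∀ x y, ⟪W x, y⟫_ℂ = ∑' mn : ℕ+ × ℕ+, ⟪w mn.1 mn.2 x, y⟫_ℂ := by
    intro x y
    exact InnerProductSpace.continuousLinearMapOfBilin_apply B x y
  have hQ : 0 ≤ Qc p := le_trans (by norm_num) (Qc_three_le hp)
  refine ⟨W, fun m n => ?_, ?_⟩
  · ext x
    refine ext_inner_right ℂ fun y => ?_
    change ⟪P m (W (P n x)), y⟫_ℂ = _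
    rw [pf_inner hP, hW, tsum_eq_single (m, n)]
    · simp only
      rw [← pf_inner hP]
      conv_rhs => rw [← hw m n]
      rfl
    · intro mn hmn
      rw [← hw mn.1 mn.2]
      change ⟪P mn.1 (w mn.1 mn.2 (P mn.2 (P n x))), P m y⟫_ℂ = 0
      by_cases h2 : mn.2 = n
      · have h1 : mn.1 ≠ m := fun h1 => hmn (Prod.ext h1 h2)
        rw [pf_inner hP, pf_orth_apply hP h1, inner_zero_right]
      · rw [pf_orth_apply hP h2]; simp
  · refine ContinuousLinearMap.opNorm_le_bound _ (by positivity) fun x => ?_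
    by_cases h0 : W x = 0
    · rw [h0, norm_zero]; positivity
    have h1 := (build_aux hP hp hc w hw hb x (W x)).2
    rw [← hW, inner_self_eq_norm_sq_to_K] at h1
    have h2 : 0 < ‖W x‖ := norm_pos_iff.mpr h0
    have h3 : ‖W x‖ ^ 2 ≤ c * Qc p * ‖x‖ * ‖W x‖ := by simpa using h1
    rw [pow_two] at h3
    exact le_of_mul_le_mul_right h3 h2

lemma schur (hP : ProjFamily P) {p c : ℝ} (hp : 1 < p) (hc : 0 ≤ c) (A : 𝓗 →L[ℂ] 𝓗)
    (hb : ∀ m n, ‖P m * A * P n‖ ≤ c * qk p m n) : ‖A‖ ≤ c * Qc p := by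
  obtain ⟨W, h1, h2⟩ := build hP hp hc (fun m n => P m * A * P n) (by
    intro m n
    simp only [mul_assoc, pf_idem hP]
    simp only [← mul_assoc, pf_idem hP]) hb
  rwa [← pf_ext hP h1]

end proj

set_option linter.unusedSectionVars false

/-! ### Weighted block bounds -/

/-- The weight `⟨m-n⟩^{-p} max{m,n}^{-2δ}`. -/
def wt (p δ : ℝ) (m n : ℕ+) : ℝ := qk p m n / mx m n ^ (2 * δ)

lemma wt_pos (p δ : ℝ) (m n : ℕ+) : 0 < wt p δ m n :=
  div_pos (qk_pos _ _ _) (Real.rpow_pos_of_pos (mx_pos _ _) _)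

lemma wt_symm (p δ : ℝ) (m n : ℕ+) : wt p δ m n = wt p δ n m := by
  unfold wt; rw [qk_symm, mx_symm]

lemma wt_le_qk {p δ : ℝ} (hδ : 0 ≤ δ) (m n : ℕ+) : wt p δ m n ≤ qk p m n := by
  unfold wt
  exact div_le_self (qk_pos _ _ _).le (Real.one_le_rpow (mx_one_le _ _) (by linarith))

/-- All blocks of `A` are bounded by `a` times the weight. -/
def Bd (P : ℕ+ → 𝓗 →L[ℂ] 𝓗) (p δ : ℝ) (A : 𝓗 →L[ℂ] 𝓗) (a : ℝ) : Prop :=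
  ∀ m n, ‖P m * A * P n‖ ≤ a * wt p δ m n

section bd
variable {P : ℕ+ → 𝓗 →L[ℂ] 𝓗}

lemma wnorm_le_iff (p δ : ℝ) (A : 𝓗 →L[ℂ] 𝓗) (a : ℝ) (m n : ℕ+) :
    wnorm P p δ A m n ≤ a ↔ ‖P m * A * P n‖ ≤ a * wt p δ m n := by
  have h1 := Real.rpow_pos_of_pos (jap_pos (((m : ℕ) : ℝ) - ((n : ℕ) : ℝ))) p
  have h2 := Real.rpow_pos_of_pos (mx_pos m n) (2 * δ)
  have e : wnorm P p δ A m n = ‖P m * A * P n‖ / wt p δ m n := by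
    unfold wnorm wt qk
    rw [mul_assoc (P m)]
    change _ * mx m n ^ (2 * δ) * ‖P m * (A * P n)‖ = _
    field_simp
  rw [e, div_le_iff₀ (wt_pos _ _ _ _)]

lemma Bd.add {p δ a b : ℝ} {A B : 𝓗 →L[ℂ] 𝓗} (hA : Bd P p δ A a) (hB : Bd P p δ B b) :
    Bd P p δ (A + B) (a + b) := by
  intro m n
  rw [mul_add, add_mul, add_mul]
  exact (norm_add_le _ _).trans (add_le_add (hA m n) (hB m n))

lemma Bd.star (hP : ProjFamily P) {p δ a : ℝ} {A : 𝓗 →L[ℂ] 𝓗} (hA : Bd P p δ A a) :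
    Bd P p δ (star A) a := by
  intro m n
  have : P m * Star.star A * P n = Star.star (P n * A * P m) := by
    rw [star_mul, star_mul, pf_star hP, pf_star hP, mul_assoc]
  rw [this, norm_star, wt_symm]
  exact hA n m

lemma Bd.nonneg {p δ a : ℝ} {A : 𝓗 →L[ℂ] 𝓗} (hA : Bd P p δ A a) : 0 ≤ a := by
  have h := (norm_nonneg _).trans (hA 1 1)
  exact nonneg_of_mul_nonneg_left h (wt_pos p δ 1 1)

lemma Bd.norm_le (hP : ProjFamily P) {p δ a : ℝ} (hp : 1 < p) (hδ : 0 ≤ δ)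
    {A : 𝓗 →L[ℂ] 𝓗} (hA : Bd P p δ A a) : ‖A‖ ≤ a * Qc p := by
  have ha := hA.nonneg
  refine schur hP hp ha A fun m n => (hA m n).trans ?_
  exact mul_le_mul_of_nonneg_left (wt_le_qk hδ m n) ha

lemma Bd.mul (hP : ProjFamily P) {p s j γ x w : ℝ} (hp : 1 < p) (hs : 0 ≤ s) (hj : 0 ≤ j)
    (hγ0 : 0 < γ) (hγ : γ < 1 / 2) {X W : 𝓗 →L[ℂ] 𝓗}
    (hX : Bd P p (s + j * γ) X x) (hW : Bd P (p + j) s W w) :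
    Bd P p (s + j * γ) (X * W) (2 ^ (p + j) * (2 * Qc p) * x * w) := by
  have hx := hX.nonneg
  have hw := hW.nonneg
  intro m n
  have hQ : 0 ≤ Qc p := le_trans (by norm_num) (Qc_three_le hp)
  have hwt := (wt_pos p (s + j * γ) m n).le
  have h2 : (0 : ℝ) < 2 ^ (p + j) := Real.rpow_pos_of_pos (by norm_num) _
  refine ContinuousLinearMap.opNorm_le_bound _ (by positivity) fun φ => ?_
  have h1 := (pf_sum hP (W (P n φ))).mapL (P m * X)
  have hS : Summable fun l => x * w * (2 ^ (p + j) * wt p (s + j * γ) m n) * ‖φ‖ *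
      (qk p m l + qk p n l) := ((qk_summable hp m).add (qk_summable hp n)).mul_left _
  have hle : ∀ l, ‖(P m * X) (P l (W (P n φ)))‖ ≤
      x * w * (2 ^ (p + j) * wt p (s + j * γ) m n) * ‖φ‖ * (qk p m l + qk p n l) := by
    intro l
    have e : (P m * X) (P l (W (P n φ))) = (P m * X * P l) ((P l * W * P n) φ) := by
      change P m (X (P l (W (P n φ)))) = P m (X (P l (P l (W (P n φ)))))
      rw [pf_idem_apply hP]
    rw [e]
    have hq1 := (wt_pos p (s + j * γ) m l).le
    have hq2 := (wt_pos (p + j) s l n).le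
    calc _ ≤ ‖P m * X * P l‖ * (‖P l * W * P n‖ * ‖φ‖) :=
          (ContinuousLinearMap.le_opNorm _ _).trans
            (mul_le_mul_of_nonneg_left (ContinuousLinearMap.le_opNorm _ _) (norm_nonneg _))
      _ ≤ (x * wt p (s + j * γ) m l) * ((w * wt (p + j) s l n) * ‖φ‖) :=
          mul_le_mul (hX m l) (mul_le_mul_of_nonneg_right (hW l n) (norm_nonneg _))
            (by positivity) (by positivity)
      _ = x * w * ‖φ‖ * (wt p (s + j * γ) m l * wt (p + j) s l n) := by ring
      _ ≤ x * w * ‖φ‖ * ((2 ^ (p + j) * wt p (s + j * γ) m n) * (qk p m l + qk p n l)) :=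
          mul_le_mul_of_nonneg_left (weight_mul (by linarith) hs hj hγ0 hγ m l n)
            (by positivity)
      _ = _ := by ring
  have h3 := h1.norm_le_of_bounded hS.hasSum hle
  refine h3.trans ?_
  rw [tsum_mul_left, (qk_summable hp m).tsum_add (qk_summable hp n)]
  have h4 := qk_tsum_le hp m
  have h5 := qk_tsum_le hp n
  calc _ ≤ x * w * (2 ^ (p + j) * wt p (s + j * γ) m n) * ‖φ‖ * (Qc p + Qc p) :=
        mul_le_mul_of_nonneg_left (add_le_add h4 h5) (by positivity)
    _ = _ := by ring

end bd

/-! ### The fixed point -/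

/-- Standing assumptions. -/
structure Setup (P : ℕ+ → 𝓗 →L[ℂ] 𝓗) (E : ℕ+ → ℝ) (γ cH s r K : ℝ)
    (Y : 𝓗 →L[ℂ] 𝓗) (y : ℝ) (Z : 𝓗 →L[ℂ] 𝓗) (z : ℝ) : Prop where
  hP : ProjFamily P
  hγ0 : 0 < γ
  hγ : γ < 1 / 2
  hcH : 0 < cH
  hgap : ∀ m n : ℕ+, cH * |((m : ℕ) : ℝ) - ((n : ℕ) : ℝ)| / mx m n ^ (2 * γ) ≤ |E m - E n|
  hs : 0 ≤ s
  hr : 2 < r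
  hYd : IsDiag P Y
  hy : 0 ≤ y
  hY : ∀ n : ℕ+, ‖Y * P n‖ ≤ y / ((n : ℕ) : ℝ) ^ (2 * γ)
  hz : 0 ≤ z
  hZ : Bd P r (s + 1 * γ) Z z
  hK : K = 2 ^ (r + 1) * (2 * Qc r)
  hK48 : 48 ≤ K
  hsmall : 12 * K * (y + z) ≤ cH

namespace Setup

variable {P : ℕ+ → 𝓗 →L[ℂ] 𝓗} {E : ℕ+ → ℝ} {γ cH s r K y z : ℝ} {Y Z : 𝓗 →L[ℂ] 𝓗}

lemma dist_eq {m n : ℕ+} (h : m ≠ n) :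
    |((m : ℕ) : ℝ) - ((n : ℕ) : ℝ)| = jap (((m : ℕ) : ℝ) - ((n : ℕ) : ℝ)) := by
  unfold jap
  rw [max_eq_right]
  have h1 : ((m : ℕ) : ℤ) - ((n : ℕ) : ℤ) ≠ 0 := by
    intro h0
    exact h (PNat.coe_injective (by omega))
  have h2 := Int.one_le_abs h1
  exact_mod_cast h2

lemma gap (S : Setup P E γ cH s r K Y y Z z) {m n : ℕ+} (h : m ≠ n) :
    |E m - E n|⁻¹ ≤ mx m n ^ (2 * γ) / (cH * jap (((m : ℕ) : ℝ) - ((n : ℕ) : ℝ))) := by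
  have h1 := S.hgap m n
  rw [dist_eq h] at h1
  have h2 := jap_pos (((m : ℕ) : ℝ) - ((n : ℕ) : ℝ))
  have h3 := Real.rpow_pos_of_pos (mx_pos m n) (2 * γ)
  have h4 := S.hcH
  rw [← inv_div]
  exact inv_anti₀ (by positivity) h1

lemma gap_pos (S : Setup P E γ cH s r K Y y Z z) {m n : ℕ+} (h : m ≠ n) :
    0 < |E m - E n| := by
  have h1 := S.hgap m n
  rw [dist_eq h] at h1
  have h2 := jap_pos (((m : ℕ) : ℝ) - ((n : ℕ) : ℝ))
  have h3 := Real.rpow_pos_of_pos (mx_pos m n) (2 * γ)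
  have h4 := S.hcH
  exact lt_of_lt_of_le (by positivity) h1

lemma gap_left (S : Setup P E γ cH s r K Y y Z z) {m n : ℕ+} (h : m ≠ n) :
    |E m - E n|⁻¹ ≤ 2 / cH * ((m : ℕ) : ℝ) ^ (2 * γ) := by
  refine (S.gap h).trans ?_
  have h2 := jap_pos (((m : ℕ) : ℝ) - ((n : ℕ) : ℝ))
  have h21 := jap_one_le (((m : ℕ) : ℝ) - ((n : ℕ) : ℝ))
  have h3 := pn_one_le m
  have h4 := S.hcH
  have h0 := S.hγ0
  have h01 := S.hγ
  have hmm : mx m m = ((m : ℕ) : ℝ) := by simp [mx]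
  have h5 : mx m n ^ (2 * γ) ≤
      2 * jap (((m : ℕ) : ℝ) - ((n : ℕ) : ℝ)) * ((m : ℕ) : ℝ) ^ (2 * γ) := by
    calc mx m n ^ (2 * γ)
        ≤ (2 * jap (((m : ℕ) : ℝ) - ((n : ℕ) : ℝ)) * ((m : ℕ) : ℝ)) ^ (2 * γ) := by
          refine Real.rpow_le_rpow (mx_pos m n).le ?_ (by linarith)
          have := mx_le_jap m m n
          rwa [hmm] at this
      _ = (2 * jap (((m : ℕ) : ℝ) - ((n : ℕ) : ℝ))) ^ (2 * γ) * ((m : ℕ) : ℝ) ^ (2 * γ) :=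
          Real.mul_rpow (by positivity) (by positivity)
      _ ≤ (2 * jap (((m : ℕ) : ℝ) - ((n : ℕ) : ℝ))) ^ (1 : ℝ) * ((m : ℕ) : ℝ) ^ (2 * γ) := by
          refine mul_le_mul_of_nonneg_right ?_ (by positivity)
          exact Real.rpow_le_rpow_of_exponent_le (by linarith) (by linarith)
      _ = _ := by rw [Real.rpow_one]
  rw [div_le_iff₀ (by positivity)]
  refine h5.trans (le_of_eq ?_)
  field_simp

lemma gap_right (S : Setup P E γ cH s r K Y y Z z) {m n : ℕ+} (h : m ≠ n) :
    |E m - E n|⁻¹ ≤ 2 / cH * ((n : ℕ) : ℝ) ^ (2 * γ) := by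
  rw [abs_sub_comm]
  exact S.gap_left h.symm

lemma div_bd (S : Setup P E γ cH s r K Y y Z z) {f : ℝ} {F : 𝓗 →L[ℂ] 𝓗}
    (hF : Bd P r (s + 1 * γ) F f) {m n : ℕ+} (h : m ≠ n) :
    |E m - E n|⁻¹ * ‖P m * F * P n‖ ≤ f / cH * wt (r + 1) s m n := by
  have hf := hF.nonneg
  have h2 := jap_pos (((m : ℕ) : ℝ) - ((n : ℕ) : ℝ))
  have h4 := S.hcH
  have h5 := mx_pos m n
  have hw := wt_pos r (s + 1 * γ) m n
  refine (mul_le_mul (S.gap h) (hF m n) (norm_nonneg _) (by positivity)).trans (le_of_eq ?_)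
  unfold wt qk
  have e1 : mx m n ^ (2 * (s + 1 * γ)) = mx m n ^ (2 * s) * mx m n ^ (2 * γ) := by
    rw [← Real.rpow_add h5]; congr 1; ring
  rw [e1, Real.rpow_add h2, Real.rpow_one]
  have p1 := Real.rpow_pos_of_pos h5 (2 * s)
  have p2 := Real.rpow_pos_of_pos h5 (2 * γ)
  have p3 := Real.rpow_pos_of_pos h2 r
  field_simp

lemma diag_wt (S : Setup P E γ cH s r K Y y Z z) {f : ℝ} {F : 𝓗 →L[ℂ] 𝓗}
    (hF : Bd P r (s + 1 * γ) F f) (n : ℕ+) :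
    ‖P n * F * P n‖ ≤ f / ((n : ℕ) : ℝ) ^ (2 * γ) := by
  have hf := hF.nonneg
  refine (hF n n).trans ?_
  have hmm : mx n n = ((n : ℕ) : ℝ) := by simp [mx]
  have hq : qk r n n = 1 := by simp [qk, jap]
  have h3 := pn_one_le n
  unfold wt
  rw [hmm, hq, mul_one_div]
  have p2 := Real.rpow_pos_of_pos (lt_of_lt_of_le one_pos h3) (2 * γ)
  have hs := S.hs
  exact div_le_div_of_nonneg_left hf p2
    (Real.rpow_le_rpow_of_exponent_le h3 (by linarith))

lemma right_bd (S : Setup P E γ cH s r K Y y Z z) {w b : ℝ} {W C : 𝓗 →L[ℂ] 𝓗}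
    (hW : Bd P (r + 1) s W w) {m n : ℕ+} (h : m ≠ n)
    (hC : ‖P n * C * P n‖ ≤ b / ((n : ℕ) : ℝ) ^ (2 * γ)) :
    |E m - E n|⁻¹ * ‖P m * W * P n * C * P n‖ ≤ 2 * b * w / cH * wt (r + 1) s m n := by
  have hw := hW.nonneg
  have hwt := wt_pos (r + 1) s m n
  have h4 := S.hcH
  have h3 := Real.rpow_pos_of_pos (lt_of_lt_of_le one_pos (pn_one_le n)) (2 * γ)
  have e : P m * W * P n * C * P n = (P m * W * P n) * (P n * C * P n) := by
    simp only [mul_assoc]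
    rw [← mul_assoc (P n) (P n), pf_idem S.hP]
  rw [e]
  calc _ ≤ (2 / cH * ((n : ℕ) : ℝ) ^ (2 * γ)) *
        ((w * wt (r + 1) s m n) * (b / ((n : ℕ) : ℝ) ^ (2 * γ))) := by
        refine mul_le_mul (S.gap_right h) ((norm_mul_le _ _).trans ?_) (norm_nonneg _)
          (by positivity)
        exact mul_le_mul (hW m n) hC (norm_nonneg _) (by positivity)
    _ = _ := by field_simp

lemma left_bd (S : Setup P E γ cH s r K Y y Z z) {w b : ℝ} {W C : 𝓗 →L[ℂ] 𝓗}
    (hW : Bd P (r + 1) s W w) {m n : ℕ+} (h : m ≠ n)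
    (hC : ‖C * P m‖ ≤ b / ((m : ℕ) : ℝ) ^ (2 * γ)) :
    |E m - E n|⁻¹ * ‖C * (P m * W * P n)‖ ≤ 2 * b * w / cH * wt (r + 1) s m n := by
  have hw := hW.nonneg
  have hwt := wt_pos (r + 1) s m n
  have h4 := S.hcH
  have h3 := Real.rpow_pos_of_pos (lt_of_lt_of_le one_pos (pn_one_le m)) (2 * γ)
  have e : C * (P m * W * P n) = (C * P m) * (P m * W * P n) := by
    simp only [mul_assoc]
    rw [← mul_assoc (P m) (P m), pf_idem S.hP]
  rw [e]
  have hb : 0 ≤ b / ((m : ℕ) : ℝ) ^ (2 * γ) := (norm_nonneg _).trans hC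
  calc _ ≤ (2 / cH * ((m : ℕ) : ℝ) ^ (2 * γ)) *
        ((b / ((m : ℕ) : ℝ) ^ (2 * γ)) * (w * wt (r + 1) s m n)) := by
        refine mul_le_mul (S.gap_left h) ((norm_mul_le _ _).trans ?_) (norm_nonneg _)
          (by positivity)
        exact mul_le_mul hC (hW m n) (norm_nonneg _) hb
    _ = _ := by field_simp

lemma ZW (S : Setup P E γ cH s r K Y y Z z) {w : ℝ} {W : 𝓗 →L[ℂ] 𝓗}
    (hW : Bd P (r + 1) s W w) : Bd P r (s + 1 * γ) (Z * W) (K * z * w) := by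
  have h := Bd.mul S.hP (by linarith [S.hr]) S.hs zero_le_one S.hγ0 S.hγ S.hZ hW
  rwa [← S.hK] at h

lemma Yblk (S : Setup P E γ cH s r K Y y Z z) (W : 𝓗 →L[ℂ] 𝓗) (m n : ℕ+) :
    P m * (Y * W) * P n = Y * (P m * W * P n) := by
  simp only [← mul_assoc]
  rw [diag_comm S.hP S.hYd]

lemma VW_off (S : Setup P E γ cH s r K Y y Z z) {w : ℝ} {W : 𝓗 →L[ℂ] 𝓗}
    (hW : Bd P (r + 1) s W w) {m n : ℕ+} (h : m ≠ n) :
    |E m - E n|⁻¹ * ‖P m * ((Y + Z) * W) * P n‖ ≤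
      (2 * y * w + K * z * w) / cH * wt (r + 1) s m n := by
  have e : P m * ((Y + Z) * W) * P n = Y * (P m * W * P n) + P m * (Z * W) * P n := by
    rw [add_mul, mul_add, add_mul, S.Yblk]
  rw [e]
  have h1 := S.left_bd hW h (S.hY m)
  have h2 := S.div_bd (S.ZW hW) h
  calc _ ≤ |E m - E n|⁻¹ * (‖Y * (P m * W * P n)‖ + ‖P m * (Z * W) * P n‖) :=
        mul_le_mul_of_nonneg_left (norm_add_le _ _) (by positivity)
    _ ≤ 2 * y * w / cH * wt (r + 1) s m n + K * z * w / cH * wt (r + 1) s m n := by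
        rw [mul_add]; exact add_le_add h1 h2
    _ = _ := by ring

lemma VW_diag (S : Setup P E γ cH s r K Y y Z z) {w : ℝ} {W : 𝓗 →L[ℂ] 𝓗}
    (hW : Bd P (r + 1) s W w) (n : ℕ+) (h0 : P n * W * P n = 0) :
    ‖P n * ((Y + Z) * W) * P n‖ ≤ (K * z * w) / ((n : ℕ) : ℝ) ^ (2 * γ) := by
  have e : P n * ((Y + Z) * W) * P n = P n * (Z * W) * P n := by
    rw [add_mul, mul_add, add_mul, S.Yblk, h0, mul_zero, zero_add]
  rw [e]
  exact S.diag_wt (S.ZW hW) n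

lemma V1W_diag (S : Setup P E γ cH s r K Y y Z z) {w : ℝ} {W : 𝓗 →L[ℂ] 𝓗}
    (hW : Bd P (r + 1) s W w) (n : ℕ+) (h0 : P n * W * P n = 0) :
    ‖P n * ((Y + Z) * (1 + W)) * P n‖ ≤ (y + z + K * z * w) / ((n : ℕ) : ℝ) ^ (2 * γ) := by
  have e : P n * ((Y + Z) * (1 + W)) * P n =
      P n * (Y * P n) + P n * Z * P n + P n * ((Y + Z) * W) * P n := by
    noncomm_ring
  have h1 : ‖P n * (Y * P n)‖ ≤ y / ((n : ℕ) : ℝ) ^ (2 * γ) := by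
    refine (norm_mul_le _ _).trans ?_
    have := mul_le_mul (pf_norm S.hP n) (S.hY n) (norm_nonneg _) zero_le_one
    simpa using this
  have h2 := S.diag_wt S.hZ n
  have h3 := S.VW_diag hW n h0
  rw [e, add_div, add_div]
  exact (norm_add_le _ _).trans (add_le_add ((norm_add_le _ _).trans (add_le_add h1 h2)) h3)

/-- The nonlinear right-hand side. -/
def Nl (P : ℕ+ → 𝓗 →L[ℂ] 𝓗) (V W : 𝓗 →L[ℂ] 𝓗) (m n : ℕ+) : 𝓗 →L[ℂ] 𝓗 :=
  P m * W * P n * (V * (1 + W)) * P n - P m * (V * (1 + W)) * P n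

/-- Admissible candidates. -/
def Good (P : ℕ+ → 𝓗 →L[ℂ] 𝓗) (r s K : ℝ) (W : 𝓗 →L[ℂ] 𝓗) : Prop :=
  (∀ n, P n * W * P n = 0) ∧ Bd P (r + 1) s W (1 / (6 * K))

lemma Nl_bd (S : Setup P E γ cH s r K Y y Z z) {W : 𝓗 →L[ℂ] 𝓗} (hW : Good P r s K W)
    {m n : ℕ+} (h : m ≠ n) :
    |E m - E n|⁻¹ * ‖Nl P (Y + Z) W m n‖ ≤ 1 / (6 * K) * wt (r + 1) s m n := by
  have h1 := S.right_bd hW.2 h (S.V1W_diag hW.2 n (hW.1 n))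
  have h2 := S.div_bd S.hZ h
  have h3 := S.VW_off hW.2 h
  have hY0 : P m * Y * P n = 0 := by rw [mul_assoc]; exact S.hYd m n h
  have e : Nl P (Y + Z) W m n = P m * W * P n * ((Y + Z) * (1 + W)) * P n
      - P m * Z * P n - P m * ((Y + Z) * W) * P n := by
    have e2 : P m * ((Y + Z) * (1 + W)) * P n =
      P m * Y * P n + P m * Z * P n + P m * ((Y + Z) * W) * P n := by
      noncomm_ring
    rw [Nl, e2, hY0, zero_add, sub_sub]
  rw [e]
  have hw := wt_pos (r + 1) s m n
  have hK := S.hK48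
  have hc := S.hcH
  have hsm := S.hsmall
  have hy := S.hy
  have hz := S.hz
  calc _ ≤ |E m - E n|⁻¹ * (‖P m * W * P n * ((Y + Z) * (1 + W)) * P n‖ + ‖P m * Z * P n‖ +
        ‖P m * ((Y + Z) * W) * P n‖) :=
        mul_le_mul_of_nonneg_left ((norm_sub_le _ _).trans
          (add_le_add (norm_sub_le _ _) le_rfl)) (by positivity)
    _ ≤ ((2 * (y + z + K * z * (1 / (6 * K))) * (1 / (6 * K)) + z +
          (2 * y * (1 / (6 * K)) + K * z * (1 / (6 * K)))) / cH) * wt (r + 1) s m n := by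
        rw [mul_add, mul_add]
        refine (add_le_add (add_le_add h1 h2) h3).trans (le_of_eq ?_)
        ring
    _ ≤ _ := by
        refine mul_le_mul_of_nonneg_right ?_ hw.le
        rw [div_le_iff₀ hc]
        have e3 : 2 * (y + z + K * z * (1 / (6 * K))) * (1 / (6 * K)) + z +
          (2 * y * (1 / (6 * K)) + K * z * (1 / (6 * K))) =
          (1 / (6 * K)) * (4 * y + 7 / 3 * z + 7 * K * z) := by field_simp; ring
        rw [e3]
        refine mul_le_mul_of_nonneg_left ?_ (by positivity)
        nlinarith [mul_nonneg (by linarith : 0 ≤ K - 48) hy, mul_nonneg (by linarith : 0 ≤ K - 48) hz]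

lemma Nl_diff (S : Setup P E γ cH s r K Y y Z z) {W W' : 𝓗 →L[ℂ] 𝓗} (hW : Good P r s K W)
    (hW' : Good P r s K W') {d : ℝ} (hd : Bd P (r + 1) s (W - W') d) {m n : ℕ+} (h : m ≠ n) :
    |E m - E n|⁻¹ * ‖Nl P (Y + Z) W m n - Nl P (Y + Z) W' m n‖ ≤
      d / 2 * wt (r + 1) s m n := by
  have h0 : P n * (W - W') * P n = 0 := by
    rw [mul_sub, sub_mul, hW.1, hW'.1, sub_zero]
  have h1 := S.right_bd hd h (S.V1W_diag hW.2 n (hW.1 n))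
  have h2 := S.right_bd hW'.2 h (S.VW_diag hd n h0)
  have h3 := S.VW_off hd h
  have e : Nl P (Y + Z) W m n - Nl P (Y + Z) W' m n =
      P m * (W - W') * P n * ((Y + Z) * (1 + W)) * P n
      + P m * W' * P n * ((Y + Z) * (W - W')) * P n - P m * ((Y + Z) * (W - W')) * P n := by
    unfold Nl
    generalize Y + Z = V
    noncomm_ring
  rw [e]
  have hw := wt_pos (r + 1) s m n
  have hK := S.hK48
  have hc := S.hcH
  have hsm := S.hsmall
  have hy := S.hy
  have hz := S.hz
  have hd0 := hd.nonneg
  calc _ ≤ |E m - E n|⁻¹ * (‖P m * (W - W') * P n * ((Y + Z) * (1 + W)) * P n‖ +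
        ‖P m * W' * P n * ((Y + Z) * (W - W')) * P n‖ + ‖P m * ((Y + Z) * (W - W')) * P n‖) :=
        mul_le_mul_of_nonneg_left ((norm_sub_le _ _).trans
          (add_le_add (norm_add_le _ _) le_rfl)) (by positivity)
    _ ≤ ((2 * (y + z + K * z * (1 / (6 * K))) * d + 2 * (K * z * d) * (1 / (6 * K)) +
          (2 * y * d + K * z * d)) / cH) * wt (r + 1) s m n := by
        rw [mul_add, mul_add]
        refine (add_le_add (add_le_add h1 h2) h3).trans (le_of_eq ?_)
        ring
    _ ≤ _ := by
        refine mul_le_mul_of_nonneg_right ?_ hw.le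
        rw [div_le_iff₀ hc]
        have e3 : 2 * (y + z + K * z * (1 / (6 * K))) * d + 2 * (K * z * d) * (1 / (6 * K)) +
          (2 * y * d + K * z * d) = d * (4 * y + 8 / 3 * z + K * z) := by field_simp; ring
        rw [e3, show d / 2 * cH = d * (cH / 2) by ring]
        refine mul_le_mul_of_nonneg_left ?_ hd0
        nlinarith [mul_nonneg (by linarith : 0 ≤ K - 48) hy, mul_nonneg (by linarith : 0 ≤ K - 48) hz]

lemma Nl_blk (hP : ProjFamily P) (V W : 𝓗 →L[ℂ] 𝓗) (m n : ℕ+) :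
    P m * Nl P V W m n * P n = Nl P V W m n := by
  have h1 : ∀ n, P n * P n = P n := pf_idem hP
  unfold Nl
  simp only [mul_sub, sub_mul]
  simp only [mul_assoc, h1]
  simp only [← mul_assoc, h1]

lemma step (S : Setup P E γ cH s r K Y y Z z) {W : 𝓗 →L[ℂ] 𝓗} (hW : Good P r s K W) :
    ∃ W', Good P r s K W' ∧ ∀ m n, m ≠ n →
      ((E m - E n : ℝ) : ℂ) • (P m * W' * P n) = Nl P (Y + Z) W m n := by
  have hK := S.hK48
  let b : ℕ+ → ℕ+ → 𝓗 →L[ℂ] 𝓗 := fun m n =>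
    if m = n then 0 else (((E m - E n : ℝ) : ℂ)⁻¹) • Nl P (Y + Z) W m n
  have hb : ∀ m n, ‖b m n‖ ≤ 1 / (6 * K) * wt (r + 1) s m n := by
    intro m n
    have hw := wt_pos (r + 1) s m n
    by_cases h : m = n
    · simp only [b, if_pos h, norm_zero]
      positivity
    · simp only [b, if_neg h]
      have := S.Nl_bd hW h
      rwa [norm_smul, norm_inv, Complex.norm_real, Real.norm_eq_abs]
  obtain ⟨W', h1, -⟩ := build S.hP (p := r + 1) (c := 1 / (6 * K)) (by linarith [S.hr])
    (by positivity) b (by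
      intro m n
      by_cases h : m = n
      · simp only [b, if_pos h, mul_zero, zero_mul]
      · simp only [b, if_neg h]
        rw [mul_smul_comm, smul_mul_assoc, Nl_blk S.hP]) (by
      intro m n
      exact (hb m n).trans (mul_le_mul_of_nonneg_left (wt_le_qk S.hs m n) (by positivity)))
  refine ⟨W', ⟨fun n => ?_, fun m n => ?_⟩, fun m n h => ?_⟩
  · rw [h1]; simp [b]
  · rw [h1]; exact hb m n
  · rw [h1]
    simp only [b, if_neg h]
    have h2 : ((E m - E n : ℝ) : ℂ) ≠ 0 := by
      have := abs_pos.mp (S.gap_pos h)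
      exact_mod_cast this
    rw [smul_smul, mul_inv_cancel₀ h2, one_smul]

lemma exists_W (S : Setup P E γ cH s r K Y y Z z) :
    ∃ W, Good P r s K W ∧ ∀ m n, m ≠ n →
      ((E m - E n : ℝ) : ℂ) • (P m * W * P n) = Nl P (Y + Z) W m n := by
  have hK := S.hK48
  have hzero : Good P r s K (0 : 𝓗 →L[ℂ] 𝓗) := by
    refine ⟨fun n => by simp, fun m n => ?_⟩
    have hw := wt_pos (r + 1) s m n
    simp only [mul_zero, zero_mul, norm_zero]
    positivity
  choose F hF1 hF2 using fun W : {W : 𝓗 →L[ℂ] 𝓗 // Good P r s K W} => S.step W.2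
  let G : {W : 𝓗 →L[ℂ] 𝓗 // Good P r s K W} → {W : 𝓗 →L[ℂ] 𝓗 // Good P r s K W} :=
    fun W => ⟨F W, hF1 W⟩
  let u : ℕ → {W : 𝓗 →L[ℂ] 𝓗 // Good P r s K W} := fun j => G^[j] ⟨0, hzero⟩
  have hu : ∀ j, u (j + 1) = G (u j) := fun j => Function.iterate_succ_apply' G j _
  have hG : ∀ A B : {W : 𝓗 →L[ℂ] 𝓗 // Good P r s K W}, ∀ d, Bd P (r + 1) s (A.1 - B.1) d →
      Bd P (r + 1) s ((G A).1 - (G B).1) (d / 2) := by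
    intro A B d hd m n
    have hd0 := hd.nonneg
    by_cases h : m = n
    · subst h
      have : P m * ((G A).1 - (G B).1) * P m = 0 := by
        rw [mul_sub, sub_mul, (G A).2.1, (G B).2.1, sub_zero]
      rw [this, norm_zero]
      have hw := wt_pos (r + 1) s m m
      positivity
    · have h1 := S.Nl_diff A.2 B.2 hd h
      rw [← hF2 A m n h, ← hF2 B m n h, ← smul_sub, norm_smul, Complex.norm_real,
        Real.norm_eq_abs, ← mul_assoc, inv_mul_cancel₀ (S.gap_pos h).ne', one_mul] at h1
      rwa [mul_sub, sub_mul]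
  have hdiff : ∀ j, Bd P (r + 1) s ((u (j + 1)).1 - (u j).1) (1 / (6 * K) * (1 / 2) ^ j) := by
    intro j
    induction j with
    | zero =>
      have h1 : (u 0).1 = 0 := rfl
      rw [h1, sub_zero, pow_zero, mul_one]
      exact (u 1).2.2
    | succ j ih =>
      have := hG _ _ _ ih
      rw [← hu, ← hu] at this
      rw [pow_succ]
      convert this using 1
      ring
  have hcau : CauchySeq (fun j => (u j).1) := by
    refine cauchySeq_of_le_geometric (1 / 2) (1 / (6 * K) * Qc (r + 1)) (by norm_num) fun j => ?_
    rw [dist_comm, dist_eq_norm]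
    refine ((hdiff j).norm_le S.hP (by linarith [S.hr]) S.hs).trans (le_of_eq ?_)
    ring
  obtain ⟨W, hW⟩ := cauchySeq_tendsto_of_complete hcau
  have hblk : ∀ m n, Filter.Tendsto (fun j => P m * (u j).1 * P n) Filter.atTop
      (nhds (P m * W * P n)) := fun m n => (hW.const_mul (P m)).mul_const (P n)
  refine ⟨W, ⟨fun n => ?_, fun m n => ?_⟩, fun m n h => ?_⟩
  · refine tendsto_nhds_unique (hblk n n) ?_
    simp only [(u _).2.1]
    exact tendsto_const_nhds
  · exact le_of_tendsto (hblk m n).norm (Filter.Eventually.of_forall fun j => (u j).2.2 m n)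
  · have h1 : Filter.Tendsto (fun j => Nl P (Y + Z) (u j).1 m n) Filter.atTop
        (nhds (Nl P (Y + Z) W m n)) := by
      unfold Nl
      have h2 : Filter.Tendsto (fun j => (Y + Z) * (1 + (u j).1)) Filter.atTop
        (nhds ((Y + Z) * (1 + W))) := (hW.const_add 1).const_mul _
      exact (((hblk m n).mul h2).mul_const _).sub ((h2.const_mul _).mul_const _)
    have h2 := ((hblk m n).comp (Filter.tendsto_add_atTop_nat 1)).const_smul
      ((E m - E n : ℝ) : ℂ)
    refine tendsto_nhds_unique h2 (h1.congr fun j => ?_)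
    simp only [Function.comp]
    rw [hu]
    exact (hF2 (u j) m n h).symm

end Setup

set_option linter.unusedSectionVars false

/-! ### The unbounded operator -/

section unb
variable {P : ℕ+ → 𝓗 →L[ℂ] 𝓗} {E : ℕ+ → ℝ}

/-- Componentwise form of `h = H ψ`. -/
def HG (P : ℕ+ → 𝓗 →L[ℂ] 𝓗) (E : ℕ+ → ℝ) (ψ h : 𝓗) : Prop :=
  ∀ m, (E m : ℂ) • P m ψ = P m h

lemma HG_iff (hP : ProjFamily P) (ψ h : 𝓗) : IsHSum P E ψ h ↔ HG P E ψ h := by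
  constructor
  · intro hh m
    have h1 := hh.mapL (P m)
    have h2 : ∀ n, n ≠ m → P m ((E n : ℂ) • P n ψ) = 0 := by
      intro n hn
      rw [map_smul, pf_orth_apply hP hn.symm, smul_zero]
    have h3 := h1.unique (hasSum_single m h2)
    rw [h3, map_smul, pf_idem_apply hP]
  · intro hh
    unfold IsHSum
    have := pf_sum hP h
    simp only [← hh _] at this
    exact this

lemma HG_dom (hP : ProjFamily P) {ψ h : 𝓗} (hh : HG P E ψ h) : ψ ∈ HDom P E := by
  have := (pf_sq hP h).summable
  refine this.congr fun n => ?_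
  rw [← hh n, norm_smul, mul_pow, Complex.norm_real, Real.norm_eq_abs, sq_abs]

lemma HG_unique (hP : ProjFamily P) {ψ h h' : 𝓗} (hh : HG P E ψ h) (hh' : HG P E ψ h') :
    h = h' := pf_ext_vec hP fun m => by rw [← hh m, hh' m]

lemma HG_exists (hP : ProjFamily P) {ψ : 𝓗} (hψ : ψ ∈ HDom P E) : ∃ h, HG P E ψ h := by
  have ho : OrthogonalFamily ℂ (fun n : ℕ+ => (LinearMap.range (P n : 𝓗 →ₗ[ℂ] 𝓗)))
      (fun n => (LinearMap.range (P n : 𝓗 →ₗ[ℂ] 𝓗)).subtypeₗᵢ) := by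
    intro m n hmn x y
    obtain ⟨_, x, rfl⟩ := x
    obtain ⟨_, y, rfl⟩ := y
    change ⟪P m x, P n y⟫_ℂ = 0
    rw [pf_inner hP, pf_orth_apply hP hmn, inner_zero_right]
  have h1 := ho.summable_iff_norm_sq_summable
    (fun n => ⟨(E n : ℂ) • P n ψ, ⟨(E n : ℂ) • ψ, by simp⟩⟩)
  have h2 : Summable fun n => (E n : ℂ) • P n ψ := by
    refine h1.mpr ?_
    refine Summable.congr hψ fun n => ?_
    change _ = ‖(E n : ℂ) • P n ψ‖ ^ 2
    rw [norm_smul, mul_pow, Complex.norm_real, Real.norm_eq_abs, sq_abs]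
  obtain ⟨h, hh⟩ := h2
  exact ⟨h, (HG_iff hP ψ h).mp hh⟩

/-- Blockwise form of `[H, C] = F`. -/
def Cm (P : ℕ+ → 𝓗 →L[ℂ] 𝓗) (E : ℕ+ → ℝ) (C F : 𝓗 →L[ℂ] 𝓗) : Prop :=
  ∀ m n, ((E m - E n : ℝ) : ℂ) • (P m * C * P n) = P m * F * P n

lemma Cm.hg (hP : ProjFamily P) {C F : 𝓗 →L[ℂ] 𝓗} (hC : Cm P E C F) {ψ h : 𝓗}
    (hh : HG P E ψ h) : HG P E (C ψ) (C h + F ψ) := by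
  intro m
  have h1 := ((pf_sum hP ψ).mapL (P m * C)).const_smul (E m : ℂ)
  have h2 := (((pf_sum hP h).mapL (P m * C)).add ((pf_sum hP ψ).mapL (P m * F)))
  rw [map_add]
  refine h1.unique ?_
  convert h2 using 1
  funext n
  have h3 := congrArg (fun A : 𝓗 →L[ℂ] 𝓗 => A ψ) (hC m n)
  change ((E m - E n : ℝ) : ℂ) • P m (C (P n ψ)) = P m (F (P n ψ)) at h3
  change (E m : ℂ) • P m (C (P n ψ)) = P m (C (P n h)) + P m (F (P n ψ))
  rw [← h3, ← hh n, map_smul, map_smul, Complex.ofReal_sub, sub_smul]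
  abel
  rfl

lemma Cm.star (hP : ProjFamily P) {C F : 𝓗 →L[ℂ] 𝓗} (hC : Cm P E C F) :
    Cm P E (Star.star C) (-Star.star F) := by
  intro m n
  have h := congrArg Star.star (hC n m)
  simp only [star_smul, star_mul, pf_star hP] at h
  rw [mul_neg, neg_mul, mul_assoc, mul_assoc, ← h, ← neg_smul]
  congr 1
  simp

lemma Cm.mul (hP : ProjFamily P) {C F D G : 𝓗 →L[ℂ] 𝓗} (hC : Cm P E C F) (hD : Cm P E D G) :
    Cm P E (C * D) (F * D + C * G) := by
  intro m n
  ext φ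
  have h0 : HG P E (P n φ) ((E n : ℂ) • P n φ) := by
    intro k
    rw [map_smul]
    by_cases hk : k = n
    · rw [hk]
    · rw [pf_orth_apply hP hk, smul_zero, smul_zero]
  have h1 := hC.hg hP (hD.hg hP h0) m
  change ((E m - E n : ℝ) : ℂ) • P m (C (D (P n φ))) = P m (F (D (P n φ)) + C (G (P n φ)))
  simp only [map_add, map_smul] at h1 ⊢
  rw [Complex.ofReal_sub, sub_smul, h1]
  abel

lemma Cm_diag (hP : ProjFamily P) {C : 𝓗 →L[ℂ] 𝓗} (hC : ∀ n, C * P n = P n * C) :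
    Cm P E C 0 := by
  intro m n
  by_cases h : m = n
  · subst h; simp
  · rw [← hC, mul_assoc, pf_orth hP h]; simp

end unb

namespace Setup

variable {P : ℕ+ → 𝓗 →L[ℂ] 𝓗} {E : ℕ+ → ℝ} {γ cH s r K y z : ℝ} {Y Z : 𝓗 →L[ℂ] 𝓗}

/-- The diagonal operator `B` and the intertwining relation. -/
lemma exists_B (S : Setup P E γ cH s r K Y y Z z) :
    ∃ W B, Good P r s K W ∧ (∀ n, B * P n = P n * B) ∧
      (∀ n : ℕ+, ‖B * P n‖ ≤ (y + 7 / 6 * z) / ((n : ℕ) : ℝ) ^ (2 * γ)) ∧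
      Cm P E (1 + W) ((1 + W) * B - (Y + Z) * (1 + W)) := by
  obtain ⟨W, hW, hWN⟩ := S.exists_W
  have hK := S.hK48
  have hP := S.hP
  set M := (Y + Z) * (1 + W) with hM
  have hidem : ∀ n (A : 𝓗 →L[ℂ] 𝓗), P n * (P n * A) = P n * A := fun n A => by
    rw [← mul_assoc, pf_idem hP]
  obtain ⟨B, hB, -⟩ := build hP (p := r) (c := ‖M‖) (by linarith [S.hr]) (norm_nonneg _)
    (fun m n => if m = n then P n * M * P n else 0) (by
      intro m n
      by_cases h : m = n
      · subst h
        simp only [if_true, mul_assoc, pf_idem hP, hidem]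
      · simp [h]) (by
      intro m n
      by_cases h : m = n
      · subst h
        have h1 : qk r m m = 1 := by simp [qk, jap]
        simp only [if_true, h1, mul_one]
        calc ‖P m * M * P m‖ ≤ ‖P m‖ * ‖M‖ * ‖P m‖ :=
              (norm_mul_le _ _).trans (mul_le_mul_of_nonneg_right (norm_mul_le _ _) (norm_nonneg _))
          _ ≤ 1 * ‖M‖ * 1 := by
              have := pf_norm hP m
              gcongr
          _ = ‖M‖ := by ring
      · simp only [if_neg h, norm_zero]
        exact mul_nonneg (norm_nonneg _) (qk_pos _ _ _).le)
  have hBd : IsDiag P B := by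
    intro m n h
    change P m * (B * P n) = 0
    rw [← mul_assoc, hB, if_neg h]
  have hBc := diag_comm hP hBd
  have hBP : ∀ n, B * P n = P n * M * P n := fun n => by
    rw [diag_right hP hBd, hB, if_pos rfl]
  refine ⟨W, B, hW, hBc, fun n => ?_, fun m n => ?_⟩
  · rw [hBP]
    have h1 := S.V1W_diag hW.2 n (hW.1 n)
    refine h1.trans (le_of_eq ?_)
    congr 1
    field_simp
    ring
  · have e : P m * ((1 + W) * B - M) * P n =
        P m * P n * M * P n + P m * W * P n * M * P n - P m * M * P n := by
      have : P m * ((1 + W) * B - M) * P n =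
        P m * (B * P n) + P m * W * (B * P n) - P m * M * P n := by noncomm_ring
      rw [this, hBP]
      simp only [mul_assoc]
    rw [e]
    by_cases h : m = n
    · subst h
      rw [hW.1, pf_idem hP]
      simp
    · rw [pf_orth hP h, mul_add, add_mul, mul_one, pf_orth hP h, zero_add, hWN m n h, Nl]
      simp only [zero_mul, zero_add, ← hM]

lemma W_norm (S : Setup P E γ cH s r K Y y Z z) {W : 𝓗 →L[ℂ] 𝓗} (hW : Good P r s K W) :
    ‖W‖ ≤ 1 / 96 := by
  have hr := S.hr
  have hK := S.hK48
  have hQ := Qc_three_le (p := r) (by linarith)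
  have h1 := schur S.hP (p := r) (c := 1 / (6 * K)) (by linarith) (by positivity) W (by
    intro m n
    refine (hW.2 m n).trans (mul_le_mul_of_nonneg_left ?_ (by positivity))
    refine (wt_le_qk S.hs m n).trans ?_
    unfold qk
    have h2 := jap_one_le (((m : ℕ) : ℝ) - ((n : ℕ) : ℝ))
    exact inv_anti₀ (Real.rpow_pos_of_pos (by linarith) _)
      (Real.rpow_le_rpow_of_exponent_le h2 (by linarith)))
  refine h1.trans ?_
  have h3 : (8 : ℝ) ≤ 2 ^ (r + 1) := by
    calc (8 : ℝ) = 2 ^ (3 : ℝ) := by norm_num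
      _ ≤ _ := Real.rpow_le_rpow_of_exponent_le (by norm_num) (by linarith)
  have h4 : 16 * Qc r ≤ K := by
    rw [S.hK]; nlinarith
  rw [div_mul_eq_mul_div, div_le_div_iff₀ (by positivity) (by norm_num)]
  linarith

lemma G_off (S : Setup P E γ cH s r K Y y Z z) {G B : 𝓗 →L[ℂ] 𝓗}
    (hBc : ∀ n, B * P n = P n * B)
    (hB : ∀ n : ℕ+, ‖B * P n‖ ≤ (y + 7 / 6 * z) / ((n : ℕ) : ℝ) ^ (2 * γ))
    (hG : Cm P E G (G * B - star B * G)) {m n : ℕ+} (h : m ≠ n) : P m * G * P n = 0 := by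
  have hP := S.hP
  have hK := S.hK48
  have hc := S.hcH
  have hy := S.hy
  have hz := S.hz
  have hsm := S.hsmall
  have hn := Real.rpow_pos_of_pos (lt_of_lt_of_le one_pos (pn_one_le n)) (2 * γ)
  have hm := Real.rpow_pos_of_pos (lt_of_lt_of_le one_pos (pn_one_le m)) (2 * γ)
  have hBs : ∀ n, star B * P n = P n * star B := fun n => by
    have := congrArg star (hBc n)
    simpa [star_mul, pf_star hP] using this.symm
  have hBsn : ∀ n, ‖P n * star B‖ = ‖B * P n‖ := fun n => by
    rw [← norm_star, star_mul, star_star, pf_star hP]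
  have e : P m * (G * B - star B * G) * P n =
      (P m * G * P n) * (B * P n) - (P m * star B) * (P m * G * P n) := by
    have e1 : P m * G * P n * (B * P n) = P m * G * (B * P n) := by
      rw [hBc, mul_assoc (P m * G), ← mul_assoc (P n), pf_idem hP]
    have e2 : P m * star B * (P m * G * P n) = P m * star B * G * P n := by
      rw [← hBs]
      simp only [mul_assoc]
      rw [← mul_assoc (P m) (P m), pf_idem hP]
    rw [e1, e2]
    noncomm_ring
  have h1 := congrArg norm (hG m n)
  rw [e, norm_smul, Complex.norm_real, Real.norm_eq_abs] at h1
  set g := ‖P m * G * P n‖ with hg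
  have hg0 : 0 ≤ g := norm_nonneg _
  have h2 : |E m - E n| * g ≤ g * ((y + 7 / 6 * z) / ((n : ℕ) : ℝ) ^ (2 * γ)) +
      ((y + 7 / 6 * z) / ((m : ℕ) : ℝ) ^ (2 * γ)) * g := by
    rw [h1]
    refine (norm_sub_le _ _).trans (add_le_add ?_ ?_)
    · exact (norm_mul_le _ _).trans (mul_le_mul_of_nonneg_left (hB n) hg0)
    · refine (norm_mul_le _ _).trans (mul_le_mul_of_nonneg_right ?_ hg0)
      rw [hBsn]; exact hB m
  have hD := S.gap_pos h
  have h3 := S.gap_left h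
  have h4 := S.gap_right h
  have h5 : cH / 2 / ((m : ℕ) : ℝ) ^ (2 * γ) ≤ |E m - E n| := by
    rw [div_le_iff₀ hm]
    rw [inv_le_iff_one_le_mul₀ hD] at h3
    have : cH / 2 * 1 ≤ cH / 2 * (2 / cH * ((m : ℕ) : ℝ) ^ (2 * γ) * |E m - E n|) := by gcongr
    calc cH / 2 = cH / 2 * 1 := by ring
      _ ≤ _ := this
      _ = _ := by field_simp
  have h6 : cH / 2 / ((n : ℕ) : ℝ) ^ (2 * γ) ≤ |E m - E n| := by
    rw [div_le_iff₀ hn]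
    rw [inv_le_iff_one_le_mul₀ hD] at h4
    have : cH / 2 * 1 ≤ cH / 2 * (2 / cH * ((n : ℕ) : ℝ) ^ (2 * γ) * |E m - E n|) := by gcongr
    calc cH / 2 = cH / 2 * 1 := by ring
      _ ≤ _ := this
      _ = _ := by field_simp
  have h7 : y + 7 / 6 * z ≤ 1 / 4 * (cH / 2) := by nlinarith
  have h8 : (y + 7 / 6 * z) / ((n : ℕ) : ℝ) ^ (2 * γ) ≤ 1 / 4 * |E m - E n| := by
    calc _ ≤ 1 / 4 * (cH / 2) / ((n : ℕ) : ℝ) ^ (2 * γ) := by gcongr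
      _ = 1 / 4 * (cH / 2 / ((n : ℕ) : ℝ) ^ (2 * γ)) := by ring
      _ ≤ _ := by gcongr
  have h9 : (y + 7 / 6 * z) / ((m : ℕ) : ℝ) ^ (2 * γ) ≤ 1 / 4 * |E m - E n| := by
    calc _ ≤ 1 / 4 * (cH / 2) / ((m : ℕ) : ℝ) ^ (2 * γ) := by gcongr
      _ = 1 / 4 * (cH / 2 / ((m : ℕ) : ℝ) ^ (2 * γ)) := by ring
      _ ≤ _ := by gcongr
  have h10 : |E m - E n| * g ≤ 1 / 2 * (|E m - E n| * g) := by
    refine h2.trans ?_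
    have a1 := mul_le_mul_of_nonneg_left h8 hg0
    have a2 := mul_le_mul_of_nonneg_right h9 hg0
    linarith
  have h11 : |E m - E n| * g ≤ 0 := by linarith
  have h12 : g = 0 := by
    by_contra hne
    have : 0 < g := lt_of_le_of_ne hg0 (Ne.symm hne)
    have := mul_pos hD this
    linarith
  exact norm_eq_zero.mp h12

end Setup

namespace Setup

variable {P : ℕ+ → 𝓗 →L[ℂ] 𝓗} {E : ℕ+ → ℝ} {γ cH s r K y z : ℝ} {Y Z : 𝓗 →L[ℂ] 𝓗}

/-- The data from which the unitary is built: `T = S₀ U*`, `S₀ = |T|`. -/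
lemma exists_data (S : Setup P E γ cH s r K Y y Z z) (hY : IsSelfAdjoint Y)
    (hZ : IsSelfAdjoint Z) :
    ∃ W B R Q Ti : 𝓗 →L[ℂ] 𝓗, Good P r s K W ∧ (∀ n, B * P n = P n * B) ∧
      (∀ n : ℕ+, ‖B * P n‖ ≤ (y + 7 / 6 * z) / ((n : ℕ) : ℝ) ^ (2 * γ)) ∧
      Cm P E (1 + W) ((1 + W) * B - (Y + Z) * (1 + W)) ∧
      (1 + W) * Ti = 1 ∧ R * Q = 1 ∧ Q * R = 1 ∧ star R = R ∧ star Q = Q ∧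
      star (1 + W) * (1 + W) = R * R ∧ R * R * B = star B * (R * R) ∧
      (∀ n, R * P n = P n * R) ∧ (∀ n, Q * P n = P n * Q) ∧
      (∀ n, ‖Q * P n‖ ≤ 1) ∧ ‖R‖ ≤ 97 / 96 := by
  obtain ⟨W, B, hW, hBc, hB, hT⟩ := S.exists_B
  have hP := S.hP
  have hWn := S.W_norm hW
  set T := 1 + W with hTdef
  have hTu : IsUnit T := by
    have := isUnit_one_sub_of_norm_lt_one (x := -W) (by rw [norm_neg]; linarith)
    rwa [sub_neg_eq_add] at this
  obtain ⟨Ti, hTi⟩ := hTu.exists_right_inv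
  have hTs := hT.star hP
  set G := star T * T with hGdef
  have hG : Cm P E G (G * B - star B * G) := by
    have h := hTs.mul hP hT
    convert h using 1
    rw [star_sub, star_mul, star_mul, star_add Y Z, hY.star_eq, hZ.star_eq, hGdef]
    noncomm_ring
  have hGd : IsDiag P G := by
    intro m n h
    change P m * (G * P n) = 0
    rw [← mul_assoc]
    exact S.G_off hBc hB hG h
  have hGc := diag_comm hP hGd
  have hGB : G * B = star B * G := by
    rw [← sub_eq_zero]
    apply pf_ext hP
    intro m n
    rw [← hG m n]
    by_cases h : m = n
    · subst h; simp
    · rw [S.G_off hBc hB hG h]; simp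
  have hG0 : 0 ≤ G := star_mul_self_nonneg T
  have hGu : IsUnit G := (IsUnit.star hTu).mul hTu
  set R := CFC.sqrt G with hR
  have hRR : R * R = G := CFC.sqrt_mul_sqrt_self G hG0
  have hR0 : 0 ≤ R := CFC.sqrt_nonneg G
  have hRs : star R = R := (IsSelfAdjoint.of_nonneg hR0).star_eq
  have hRu : IsUnit R := (CFC.isUnit_sqrt_iff G).mpr hGu
  have hRc : ∀ n, R * P n = P n * R := by
    intro n
    have h1 : Commute G (P n) := hGc n
    rw [hR, CFC.sqrt_eq_cfc]
    exact h1.cfc_nnreal _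
  obtain ⟨Q, hRQ⟩ := hRu.exists_right_inv
  have hQR : Q * R = 1 := by
    obtain ⟨Q', hQ'⟩ := hRu.exists_left_inv
    have : Q' = Q := left_inv_eq_right_inv hQ' hRQ
    rw [← this, hQ']
  have hQs : star Q = Q := by
    have h1 := congrArg star hRQ
    rw [star_mul, hRs, star_one] at h1
    exact left_inv_eq_right_inv h1 hRQ
  have hQc : ∀ n, Q * P n = P n * Q := by
    intro n
    calc Q * P n = Q * P n * (R * Q) := by rw [hRQ, mul_one]
      _ = Q * (P n * R) * Q := by noncomm_ring
      _ = (Q * R) * P n * Q := by rw [← hRc]; noncomm_ring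
      _ = P n * Q := by rw [hQR, one_mul]
  have hRT : ∀ φ, ‖R φ‖ = ‖T φ‖ := by
    intro φ
    have h1 : ⟪R φ, R φ⟫_ℂ = ⟪T φ, T φ⟫_ℂ := by
      rw [← ContinuousLinearMap.adjoint_inner_right, ← ContinuousLinearMap.adjoint_inner_right,
        ← ContinuousLinearMap.star_eq_adjoint, ← ContinuousLinearMap.star_eq_adjoint, hRs]
      have : (R * R) φ = G φ := by rw [hRR]
      exact congrArg _ this
    rw [inner_self_eq_norm_sq_to_K, inner_self_eq_norm_sq_to_K] at h1
    have h2 : ‖R φ‖ ^ 2 = ‖T φ‖ ^ 2 := by exact_mod_cast h1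
    exact (sq_eq_sq₀ (norm_nonneg _) (norm_nonneg _)).mp h2
  refine ⟨W, B, R, Q, Ti, hW, hBc, hB, hT, hTi, hRQ, hQR, hRs, hQs, hRR.symm, ?_, hRc, hQc, ?_, ?_⟩
  · rw [hRR, hGB]
  · intro n
    refine ContinuousLinearMap.opNorm_le_bound _ zero_le_one fun φ => ?_
    have e1 : (Q * P n) φ = P n (Q (P n φ)) := by
      have h3 : Q * P n = P n * (Q * P n) := by
        rw [hQc, ← mul_assoc, pf_idem hP]
      exact congrArg (fun A : 𝓗 →L[ℂ] 𝓗 => A φ) h3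
    set ψ := Q (P n φ) with hψ
    have e2 : R ψ = P n φ :=
      congrArg (fun A : 𝓗 →L[ℂ] 𝓗 => A (P n φ)) hRQ
    have e3 : P n ψ = ψ := e1.symm
    have e4 : P n (T ψ) = ψ := by
      have h3 : P n * T * P n = P n := by
        rw [hTdef, mul_add, add_mul, mul_one, pf_idem hP, hW.1, add_zero]
      have h4 := congrArg (fun A : 𝓗 →L[ℂ] 𝓗 => A ψ) h3
      change P n (T (P n ψ)) = P n ψ at h4
      rwa [e3] at h4
    change ‖ψ‖ ≤ _
    calc ‖ψ‖ = ‖P n (T ψ)‖ := by rw [e4]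
      _ ≤ ‖T ψ‖ := pf_le hP n _
      _ = ‖P n φ‖ := by rw [← hRT, e2]
      _ ≤ ‖φ‖ := pf_le hP n _
      _ = 1 * ‖φ‖ := by ring
  · refine ContinuousLinearMap.opNorm_le_bound _ (by norm_num) fun φ => ?_
    rw [hRT]
    change ‖φ + W φ‖ ≤ _
    have h5 := W.le_opNorm φ
    have h6 := mul_le_mul_of_nonneg_right hWn (norm_nonneg φ)
    have h7 := norm_add_le φ (W φ)
    linarith

lemma main (S : Setup P E γ cH s r K Y y Z z) (hY : IsSelfAdjoint Y)
    (hZ : IsSelfAdjoint Z) :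
    ∃ (U A : 𝓗 →L[ℂ] 𝓗), IsUnitaryOp U ∧ IsSelfAdjoint A ∧ IsDiag P A ∧
      (∀ n : ℕ+, ((n : ℕ) : ℝ) ^ (2 * γ) * ‖A.comp (P n)‖ ≤ 2 * (y + z)) ∧
      (⇑(star U) '' HDom P E = HDom P E) ∧
      (∀ ψ ∈ HDom P E, ∀ h₁ h₂ : 𝓗,
        IsHSum P E (star U ψ) h₁ → IsHSum P E ψ h₂ →
        U (h₁ + Y (star U ψ) + Z (star U ψ)) = h₂ + A ψ) ∧
      (∀ (X : 𝓗 →L[ℂ] 𝓗) (x : ℝ), Bd P (r - 1) (s + 2 * γ) X x →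
        Bd P (r - 1) (s + 2 * γ) (U * (X * star U))
          (Real.exp (2 * (2 ^ (r + 1) * Qc (r - 1)) / K) * x)) := by
  obtain ⟨W, B, R, Q, Ti, hW, hBc, hB, hT, hTi, hRQ, hQR, hRs, hQs, hRR, hRB, hRc, hQc, hQn, hRn⟩ :=
    S.exists_data hY hZ
  have hP := S.hP
  have hK := S.hK48
  set T := 1 + W with hTdef
  have hUs : star (Q * star T) = T * Q := by rw [star_mul, star_star, hQs]
  have hU1 : Q * star T * (T * Q) = 1 := by
    calc _ = Q * (star T * T) * Q := by noncomm_ring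
      _ = (Q * R) * (R * Q) := by rw [hRR]; noncomm_ring
      _ = 1 := by rw [hQR, hRQ, mul_one]
  have hU2 : T * Q * (Q * star T) = 1 := by
    have h1 : T * Q * (Q * star T) * T = T := by
      calc _ = T * Q * Q * (star T * T) := by noncomm_ring
        _ = T * Q * (Q * R) * R := by rw [hRR]; noncomm_ring
        _ = T * Q * 1 * R := by rw [hQR]
        _ = T * (Q * R) := by noncomm_ring
        _ = T := by rw [hQR, mul_one]
    calc _ = T * Q * (Q * star T) * (T * Ti) := by rw [hTi, mul_one]
      _ = T * Q * (Q * star T) * T * Ti := by noncomm_ring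
      _ = 1 := by rw [h1, hTi]
  have hQQ : Q * star B * R = R * B * Q := by
    calc Q * star B * R = Q * star B * R * (R * Q) := by rw [hRQ, mul_one]
      _ = Q * (star B * (R * R)) * Q := by noncomm_ring
      _ = (Q * R) * R * B * Q := by rw [← hRB]; noncomm_ring
      _ = _ := by rw [hQR, one_mul]
  have hAc : ∀ n, R * B * Q * P n = P n * (R * B * Q) := by
    intro n
    rw [mul_assoc, hQc, ← mul_assoc, mul_assoc R, hBc, ← mul_assoc, hRc]
    noncomm_ring
  have hTg : ∀ {ψ h : 𝓗}, HG P E ψ h →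
      HG P E ((T * Q) ψ) (T (Q h) + (T * B - (Y + Z) * T) (Q ψ)) := by
    intro ψ h hh
    have h1 := (Cm_diag hP hQc).hg hP hh
    have h2 := hT.hg hP h1
    simpa using h2
  have hUg : ∀ {ψ h : 𝓗}, HG P E ψ h → ∃ h', HG P E ((Q * star T) ψ) h' := by
    intro ψ h hh
    exact ⟨_, (Cm_diag hP hQc).hg hP ((hT.star hP).hg hP hh)⟩
  refine ⟨Q * star T, R * B * Q, ⟨?_, ?_⟩, ?_, comm_diag hP hAc, ?_, ?_, ?_, ?_⟩
  · rw [hUs, hU1]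
  · rw [hUs, hU2]
  · change star (R * B * Q) = _
    rw [star_mul, star_mul, hRs, hQs, ← mul_assoc, hQQ]
  · intro n
    change _ * ‖R * B * Q * P n‖ ≤ _
    have hn := Real.rpow_pos_of_pos (lt_of_lt_of_le one_pos (pn_one_le n)) (2 * γ)
    have hy := S.hy
    have hz := S.hz
    have e : R * B * Q * P n = R * ((B * P n) * (Q * P n)) := by
      have : B * P n * (Q * P n) = B * (Q * P n) := by
        rw [hQc, mul_assoc, ← mul_assoc (P n), pf_idem hP]
      rw [this]
      noncomm_ring
    have h1 : ‖R * B * Q * P n‖ ≤ 97 / 96 * ((y + 7 / 6 * z) / ((n : ℕ) : ℝ) ^ (2 * γ) * 1) := by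
      rw [e]
      refine (norm_mul_le _ _).trans (mul_le_mul hRn ?_ (norm_nonneg _) (by norm_num))
      exact (norm_mul_le _ _).trans (mul_le_mul (hB n) (hQn n) (norm_nonneg _) (by positivity))
    calc _ ≤ ((n : ℕ) : ℝ) ^ (2 * γ) *
          (97 / 96 * ((y + 7 / 6 * z) / ((n : ℕ) : ℝ) ^ (2 * γ) * 1)) := by gcongr
      _ = 97 / 96 * (y + 7 / 6 * z) := by field_simp
      _ ≤ _ := by linarith
  · rw [hUs]
    apply Set.Subset.antisymm
    · rintro _ ⟨ψ, hψ, rfl⟩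
      obtain ⟨h, hh⟩ := HG_exists hP hψ
      exact HG_dom hP (hTg hh)
    · intro ψ hψ
      obtain ⟨h, hh⟩ := HG_exists hP hψ
      obtain ⟨h', hh'⟩ := hUg hh
      exact ⟨_, HG_dom hP hh', congrArg (fun A : 𝓗 →L[ℂ] 𝓗 => A ψ) hU2⟩
  · intro ψ hψ h₁ h₂ hh₁ hh₂
    rw [hUs] at hh₁ ⊢
    rw [HG_iff hP] at hh₁ hh₂
    have h1 := HG_unique hP hh₁ (hTg hh₂)
    have e1 : h₁ + Y ((T * Q) ψ) + Z ((T * Q) ψ) = (T * Q) h₂ + (T * B * Q) ψ := by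
      rw [h1]
      change T (Q h₂) + (T (B (Q ψ)) - (Y (T (Q ψ)) + Z (T (Q ψ)))) + Y (T (Q ψ)) + Z (T (Q ψ)) =
        T (Q h₂) + T (B (Q ψ))
      abel
    have e2 : Q * star T * (T * B * Q) = R * B * Q := by
      calc _ = Q * (star T * T) * B * Q := by noncomm_ring
        _ = (Q * R) * R * B * Q := by rw [hRR]; noncomm_ring
        _ = _ := by rw [hQR, one_mul]
    rw [e1, map_add]
    exact congrArg₂ (· + ·) (congrArg (fun A : 𝓗 →L[ℂ] 𝓗 => A h₂) hU1)
      (congrArg (fun A : 𝓗 →L[ℂ] 𝓗 => A ψ) e2)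
  · intro X x hX m n
    rw [hUs]
    have hr := S.hr
    have hx := hX.nonneg
    set c := 2 ^ (r + 1) * (2 * Qc (r - 1)) * (1 / (6 * K)) with hc
    have hQ3 := Qc_three_le (p := r - 1) (by linarith)
    have h2 : (0 : ℝ) < 2 ^ (r + 1) := Real.rpow_pos_of_pos (by norm_num) _
    have hc0 : 0 ≤ c := by positivity
    have hmul : ∀ {X' : 𝓗 →L[ℂ] 𝓗} {x' : ℝ}, Bd P (r - 1) (s + 2 * γ) X' x' →
        Bd P (r - 1) (s + 2 * γ) (X' * T) ((1 + c) * x') := by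
      intro X' x' hX'
      have h3 := Bd.mul hP (p := r - 1) (j := 2) (w := 1 / (6 * K)) (by linarith) S.hs
        (by norm_num) S.hγ0 S.hγ hX' (by
          have := hW.2
          rwa [show r - 1 + 2 = r + 1 by ring])
      have h4 := hX'.add h3
      rw [hTdef, mul_add, mul_one]
      convert h4 using 1
      rw [hc, show r - 1 + 2 = r + 1 by ring]
      ring
    have h5 := (hmul ((hmul hX).star hP)).star hP
    have e0 : star (star (X * T) * T) = star T * (X * T) := by rw [star_mul, star_star]
    rw [e0] at h5
    set M := star T * (X * T) with hM
    have e : P m * (Q * star T * (X * (T * Q))) * P n =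
        (Q * P m) * (P m * M * P n) * (P n * Q) := by
      have e1 : P m * (Q * star T * (X * (T * Q))) * P n = (P m * Q) * M * (Q * P n) := by
        rw [hM]; noncomm_ring
      have e2 : (Q * P m) * (P m * M * P n) * (P n * Q) =
          Q * (P m * P m) * M * ((P n * P n) * Q) := by noncomm_ring
      rw [e1, e2, pf_idem hP, pf_idem hP, hQc n, hQc m]
    have hQn' : ‖P n * Q‖ ≤ 1 := by rw [← hQc]; exact hQn n
    have hwt := wt_pos (r - 1) (s + 2 * γ) m n
    have h6 : (1 + c) * (1 + c) ≤ Real.exp (2 * (2 ^ (r + 1) * Qc (r - 1)) / K) := by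
      have h7 : 1 + c ≤ Real.exp c := by linarith [Real.add_one_le_exp c]
      calc (1 + c) * (1 + c) ≤ Real.exp c * Real.exp c :=
            mul_le_mul h7 h7 (by positivity) (Real.exp_pos _).le
        _ = Real.exp (c + c) := (Real.exp_add _ _).symm
        _ ≤ _ := by
          apply Real.exp_le_exp.mpr
          have h8 : c + c = (2 / 3) * (2 ^ (r + 1) * Qc (r - 1)) / K := by
            rw [hc]; field_simp; norm_num
          rw [h8]
          gcongr
          norm_num
    calc ‖P m * (Q * star T * (X * (T * Q))) * P n‖ ≤ 1 * ‖P m * M * P n‖ * 1 := by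
          rw [e]
          refine (norm_mul_le _ _).trans (mul_le_mul ?_ hQn' (norm_nonneg _) (by positivity))
          exact (norm_mul_le _ _).trans (mul_le_mul_of_nonneg_right (hQn m) (norm_nonneg _))
      _ ≤ (1 + c) * ((1 + c) * x) * wt (r - 1) (s + 2 * γ) m n := by
          rw [one_mul, mul_one]; exact h5 m n
      _ = (1 + c) * (1 + c) * x * wt (r - 1) (s + 2 * γ) m n := by ring
      _ ≤ _ := by gcongr

end Setup

/-- Proposition 5.1: progressive diagonalization of `H + Y + Z̄`. -/
theorem statement4
    (P : ℕ+ → 𝓗 →L[ℂ] 𝓗) (hP : ProjFamily P)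
    (E : ℕ+ → ℝ) (hEmono : StrictMono E)
    (γ cH : ℝ) (hγ0 : 0 < γ) (hγh : γ < 1 / 2) (hcH : 0 < cH)
    (hgap : ∀ m n : ℕ+,
      cH * |((m : ℕ) : ℝ) - ((n : ℕ) : ℝ)| / (((max m n : ℕ+) : ℕ) : ℝ) ^ (2 * γ)
        ≤ |E m - E n|)
    (k : ℕ) (hk : 1 ≤ k) (r : ℝ) (hr : 2 < r)
    (Y : 𝓗 →L[ℂ] 𝓗) (hYsa : IsSelfAdjoint Y) (hYd : IsDiag P Y)
    (y : ℝ) (hY : ∀ n : ℕ+, ((n : ℕ) : ℝ) ^ (2 * γ) * ‖Y.comp (P n)‖ ≤ y)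
    (Zbar : 𝓗 →L[ℂ] 𝓗) (hZsa : IsSelfAdjoint Zbar)
    (z : ℝ) (hZ : ∀ m n : ℕ+, wnorm P r ((k : ℝ) * γ) Zbar m n ≤ z)
    (hsmall : y + z ≤ cH / (4 * Real.pi * Cconst (r + 1))) :
    ∃ (U A : 𝓗 →L[ℂ] 𝓗), IsUnitaryOp U ∧ IsSelfAdjoint A ∧ IsDiag P A ∧
      (∀ n : ℕ+, ((n : ℕ) : ℝ) ^ (2 * γ) * ‖A.comp (P n)‖ ≤ 2 * (y + z)) ∧
      (⇑(star U) '' HDom P E = HDom P E) ∧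
      (∀ ψ ∈ HDom P E, ∀ h₁ h₂ : 𝓗,
        IsHSum P E (star U ψ) h₁ → IsHSum P E ψ h₂ →
        U (h₁ + Y (star U ψ) + Zbar (star U ψ)) = h₂ + A ψ) ∧
      (∀ (X : 𝓗 →L[ℂ] 𝓗) (x : ℝ),
        (∀ m n : ℕ+, wnorm P (r - 1) (((k : ℝ) + 1) * γ) X m n ≤ x) →
        ∀ m n : ℕ+,
          wnorm P (r - 1) (((k : ℝ) + 1) * γ) (U.comp (X.comp (star U))) m n ≤
            Real.exp (2 * Cconst r / Cconst (r + 1)) * x) := by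
  have hQ := Qc_three_le (p := r) (by linarith)
  have hKe : Cconst (r + 1) = 2 ^ (r + 1) * (2 * Qc r) := by
    unfold Cconst Qc
    rw [show r + 1 - 1 = r by ring, Real.rpow_add_one (by norm_num) (r + 1)]
    ring
  have h3 : (8 : ℝ) ≤ 2 ^ (r + 1) := by
    calc (8 : ℝ) = 2 ^ (3 : ℝ) := by norm_num
      _ ≤ _ := Real.rpow_le_rpow_of_exponent_le (by norm_num) (by linarith)
  have hK48 : 48 ≤ Cconst (r + 1) := by
    rw [hKe]; nlinarith
  have hk' : (1 : ℝ) ≤ k := by exact_mod_cast hk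
  have hy : 0 ≤ y := le_trans (by positivity) (hY 1)
  have es : (k : ℝ) * γ = ((k : ℝ) - 1) * γ + 1 * γ := by ring
  have es2 : ((k : ℝ) + 1) * γ = ((k : ℝ) - 1) * γ + 2 * γ := by ring
  have hZb : Bd P r (((k : ℝ) - 1) * γ + 1 * γ) Zbar z := by
    intro m n
    rw [← es]
    exact (wnorm_le_iff _ _ _ _ _ _).mp (hZ m n)
  have hz := hZb.nonneg
  have S : Setup P E γ cH (((k : ℝ) - 1) * γ) r (Cconst (r + 1)) Y y Zbar z :=
    { hP := hP
      hγ0 := hγ0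
      hγ := hγh
      hcH := hcH
      hgap := hgap
      hs := mul_nonneg (by linarith) hγ0.le
      hr := hr
      hYd := hYd
      hy := hy
      hY := by
        intro n
        have hn := Real.rpow_pos_of_pos (lt_of_lt_of_le one_pos (pn_one_le n)) (2 * γ)
        rw [le_div_iff₀ hn, mul_comm]
        exact hY n
      hz := hz
      hZ := hZb
      hK := hKe
      hK48 := hK48
      hsmall := by
        have hpi := Real.pi_gt_three
        rw [le_div_iff₀ (by positivity)] at hsmall
        have h0 : 0 ≤ (y + z) * Cconst (r + 1) := by positivity
        nlinarith }
  obtain ⟨U, A, h1, h2, h3, h4, h5, h6, h7⟩ := S.main hYsa hZsa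
  refine ⟨U, A, h1, h2, h3, h4, h5, h6, fun X x hX m n => ?_⟩
  rw [wnorm_le_iff]
  have hXb : Bd P (r - 1) (((k : ℝ) - 1) * γ + 2 * γ) X x := by
    intro m n
    rw [← es2]
    exact (wnorm_le_iff _ _ _ _ _ _).mp (hX m n)
  have h8 := h7 X x hXb m n
  rw [es2]
  exact h8

end
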